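/- arXiv:2102.00296 — 3 statements merged into one kernel-verified Lean document; each statement's English description precedes it below -/
import Mathlib

section
/- For any infinite Hausdorff space X and □ ∈ {1, fin}: G_□(Ω_X, Ω_X) ≡ G_□(Ω_{P_fin(X)}, Ω_{P_fin(X)}) ≡ G_□(O_{P_fin(X)}, O_{P_fin(X)}). -/
open Set

section Covers

variable (Y : Type*) [TopologicalSpace Y]

/-- The collection `𝒯_Y` of proper nonempty open subsets of `Y`. -/
def ProperNonemptyOpens : Set (Set Y) :=
  {U | IsOpen U ∧ U.Nonempty ∧ U ≠ Set.univ}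

/-- A non-trivial open cover: an open cover not containing the whole space. -/
def IsNontrivialOpenCover (𝒰 : Set (Set Y)) : Prop :=
  (∀ U ∈ 𝒰, IsOpen U) ∧ ⋃₀ 𝒰 = Set.univ ∧ Set.univ ∉ 𝒰

/-- An ω-cover: a non-trivial open cover such that every finite subset of the
space is contained in some member. -/
def IsOmegaCover (𝒰 : Set (Set Y)) : Prop :=
  IsNontrivialOpenCover Y 𝒰 ∧ ∀ F : Set Y, F.Finite → ∃ U ∈ 𝒰, F ⊆ U

/-- A k-cover: a non-trivial open cover such that every compact proper subset of
the space is contained in some member. -/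
def IsKCover (𝒰 : Set (Set Y)) : Prop :=
  IsNontrivialOpenCover Y 𝒰 ∧ ∀ K : Set Y, IsCompact K → K ≠ Set.univ → ∃ U ∈ 𝒰, K ⊆ U

/-- An `𝒜`-cover: a non-trivial open cover such that every `A ∈ 𝒜` is contained
in some member. -/
def IsACover (𝒜 𝒰 : Set (Set Y)) : Prop :=
  IsNontrivialOpenCover Y 𝒰 ∧ ∀ A ∈ 𝒜, ∃ U ∈ 𝒰, A ⊆ U

/-- `O_Y`: the collection of non-trivial open covers of `Y`. -/
def openCovers : Set (Set (Set Y)) := {𝒰 | IsNontrivialOpenCover Y 𝒰}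

/-- `Ω_Y`: the collection of ω-covers of `Y`. -/
def omegaCovers : Set (Set (Set Y)) := {𝒰 | IsOmegaCover Y 𝒰}

/-- `K_Y`: the collection of k-covers of `Y`. -/
def kCovers : Set (Set (Set Y)) := {𝒰 | IsKCover Y 𝒰}

/-- `O(Y,𝒜)`: the collection of `𝒜`-covers of `Y`. -/
def aCovers (𝒜 : Set (Set Y)) : Set (Set (Set Y)) := {𝒰 | IsACover Y 𝒜 𝒰}

/-- Lindelöf: every open cover has a countable subcover. -/
def IsLindelofSp : Prop :=
  ∀ 𝒰 : Set (Set Y), (∀ U ∈ 𝒰, IsOpen U) → ⋃₀ 𝒰 = Set.univ →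
    ∃ 𝒱 ⊆ 𝒰, 𝒱.Countable ∧ ⋃₀ 𝒱 = Set.univ

/-- ε-space: every ω-cover has a countable subset which is still an ω-cover. -/
def IsEpsilonSpace : Prop :=
  ∀ 𝒰 : Set (Set Y), IsOmegaCover Y 𝒰 → ∃ 𝒱 ⊆ 𝒰, 𝒱.Countable ∧ IsOmegaCover Y 𝒱

/-- k-Lindelöf: every k-cover has a countable subset which is still a k-cover. -/
def IsKLindelof : Prop :=
  ∀ 𝒰 : Set (Set Y), IsKCover Y 𝒰 → ∃ 𝒱 ⊆ 𝒰, 𝒱.Countable ∧ IsKCover Y 𝒱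

end Covers

section Games

variable {ι κ : Type*}

/-- The selection principle `S_1(A, B)`. -/
def S1 (A B : Set (Set ι)) : Prop :=
  ∀ a : ℕ → Set ι, (∀ n, a n ∈ A) →
    ∃ x : ℕ → ι, (∀ n, x n ∈ a n) ∧ Set.range x ∈ B

/-- The selection principle `S_fin(A, B)`. -/
def Sfin (A B : Set (Set ι)) : Prop :=
  ∀ a : ℕ → Set ι, (∀ n, a n ∈ A) →
    ∃ F : ℕ → Set ι, (∀ n, F n ⊆ a n ∧ (F n).Finite) ∧ (⋃ n, F n) ∈ B

/-- One has a winning (full-information) strategy in the single-selection game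
`G_1(A, B)`: a function from finite sequences of Two's moves into `A` such that
every legal run produces a set of Two's selections which is not in `B`. -/
def OneWin1 (A B : Set (Set ι)) : Prop :=
  ∃ σ : List ι → Set ι, (∀ h, σ h ∈ A) ∧
    ∀ x : ℕ → ι, (∀ n, x n ∈ σ (List.ofFn fun i : Fin n => x i)) → Set.range x ∉ B

/-- One has a winning predetermined strategy in `G_1(A, B)`. -/
def OnePre1 (A B : Set (Set ι)) : Prop :=
  ∃ σ : ℕ → Set ι, (∀ n, σ n ∈ A) ∧
    ∀ x : ℕ → ι, (∀ n, x n ∈ σ n) → Set.range x ∉ B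

/-- One has a winning constant strategy in `G_1(A, B)`. -/
def OneConst1 (A B : Set (Set ι)) : Prop :=
  ∃ A₀ ∈ A, ∀ x : ℕ → ι, (∀ n, x n ∈ A₀) → Set.range x ∉ B

/-- Two has a winning (full-information) strategy in `G_1(A, B)`. -/
def TwoWin1 (A B : Set (Set ι)) : Prop :=
  ∃ τ : List (Set ι) → ι, ∀ a : ℕ → Set ι, (∀ n, a n ∈ A) →
    (∀ n, τ (List.ofFn fun i : Fin (n + 1) => a i) ∈ a n) ∧
    Set.range (fun n => τ (List.ofFn fun i : Fin (n + 1) => a i)) ∈ B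

/-- Two has a winning Markov strategy in `G_1(A, B)`. -/
def TwoMarkov1 (A B : Set (Set ι)) : Prop :=
  ∃ τ : Set ι → ℕ → ι, ∀ a : ℕ → Set ι, (∀ n, a n ∈ A) →
    (∀ n, τ (a n) n ∈ a n) ∧ Set.range (fun n => τ (a n) n) ∈ B

/-- One has a winning (full-information) strategy in the finite-selection game
`G_fin(A, B)`. -/
def OneWinFin (A B : Set (Set ι)) : Prop :=
  ∃ σ : List (Set ι) → Set ι, (∀ h, σ h ∈ A) ∧
    ∀ F : ℕ → Set ι,
      (∀ n, F n ⊆ σ (List.ofFn fun i : Fin n => F i) ∧ (F n).Finite) →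
      (⋃ n, F n) ∉ B

/-- One has a winning predetermined strategy in `G_fin(A, B)`. -/
def OnePreFin (A B : Set (Set ι)) : Prop :=
  ∃ σ : ℕ → Set ι, (∀ n, σ n ∈ A) ∧
    ∀ F : ℕ → Set ι, (∀ n, F n ⊆ σ n ∧ (F n).Finite) → (⋃ n, F n) ∉ B

/-- One has a winning constant strategy in `G_fin(A, B)`. -/
def OneConstFin (A B : Set (Set ι)) : Prop :=
  ∃ A₀ ∈ A, ∀ F : ℕ → Set ι, (∀ n, F n ⊆ A₀ ∧ (F n).Finite) → (⋃ n, F n) ∉ B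

/-- Two has a winning (full-information) strategy in `G_fin(A, B)`. -/
def TwoWinFin (A B : Set (Set ι)) : Prop :=
  ∃ τ : List (Set ι) → Set ι, ∀ a : ℕ → Set ι, (∀ n, a n ∈ A) →
    (∀ n, τ (List.ofFn fun i : Fin (n + 1) => a i) ⊆ a n ∧
      (τ (List.ofFn fun i : Fin (n + 1) => a i)).Finite) ∧
    (⋃ n, τ (List.ofFn fun i : Fin (n + 1) => a i)) ∈ B

/-- Two has a winning Markov strategy in `G_fin(A, B)`. -/
def TwoMarkovFin (A B : Set (Set ι)) : Prop :=
  ∃ τ : Set ι → ℕ → Set ι, ∀ a : ℕ → Set ι, (∀ n, a n ∈ A) →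
    (∀ n, τ (a n) n ⊆ a n ∧ (τ (a n) n).Finite) ∧ (⋃ n, τ (a n) n) ∈ B

/-- `G_1(A,C) ≤_II G_1(B,D)`. -/
def LeTwo1 (A C : Set (Set ι)) (B D : Set (Set κ)) : Prop :=
  (TwoMarkov1 A C → TwoMarkov1 B D) ∧
  (TwoWin1 A C → TwoWin1 B D) ∧
  (¬ OneWin1 A C → ¬ OneWin1 B D) ∧
  (¬ OnePre1 A C → ¬ OnePre1 B D) ∧
  (¬ OneConst1 A C → ¬ OneConst1 B D)

/-- `G_fin(A,C) ≤_II G_fin(B,D)`. -/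
def LeTwoFin (A C : Set (Set ι)) (B D : Set (Set κ)) : Prop :=
  (TwoMarkovFin A C → TwoMarkovFin B D) ∧
  (TwoWinFin A C → TwoWinFin B D) ∧
  (¬ OneWinFin A C → ¬ OneWinFin B D) ∧
  (¬ OnePreFin A C → ¬ OnePreFin B D) ∧
  (¬ OneConstFin A C → ¬ OneConstFin B D)

/-- `G_1(A,C) ≡ G_1(B,D)`. -/
def Equiv1 (A C : Set (Set ι)) (B D : Set (Set κ)) : Prop :=
  (TwoMarkov1 A C ↔ TwoMarkov1 B D) ∧
  (TwoWin1 A C ↔ TwoWin1 B D) ∧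
  (OneWin1 A C ↔ OneWin1 B D) ∧
  (OnePre1 A C ↔ OnePre1 B D) ∧
  (OneConst1 A C ↔ OneConst1 B D)

/-- `G_fin(A,C) ≡ G_fin(B,D)`. -/
def EquivFin (A C : Set (Set ι)) (B D : Set (Set κ)) : Prop :=
  (TwoMarkovFin A C ↔ TwoMarkovFin B D) ∧
  (TwoWinFin A C ↔ TwoWinFin B D) ∧
  (OneWinFin A C ↔ OneWinFin B D) ∧
  (OnePreFin A C ↔ OnePreFin B D) ∧
  (OneConstFin A C ↔ OneConstFin B D)

end Games

section Hyperspace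

variable (X : Type*) [TopologicalSpace X]

/-- `𝕂(X)`: the nonempty compact subsets of `X`. -/
abbrev KHyper := {K : Set X // IsCompact K ∧ K.Nonempty}

/-- The Vietoris topology on `𝕂(X)`, generated by the sets
`{K : K ⊆ U}` and `{K : K ∩ U ≠ ∅}` for `U` open in `X`. -/
instance (priority := 2000) vietorisTopology : TopologicalSpace (KHyper X) :=
  TopologicalSpace.generateFrom
    ({S | ∃ U : Set X, IsOpen U ∧ S = {K : KHyper X | K.1 ⊆ U}} ∪
     {S | ∃ U : Set X, IsOpen U ∧ S = {K : KHyper X | (K.1 ∩ U).Nonempty}})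

/-- `[U] = {K ∈ 𝕂(X) : K ⊆ U}`. -/
def vLower (U : Set X) : Set (KHyper X) := {K | K.1 ⊆ U}

/-- `P_fin(X)`: the subspace of `𝕂(X)` of nonempty finite subsets of `X`. -/
abbrev PFinH := {K : KHyper X // K.1.Finite}

/-- A family `𝒜` of subsets of `X` viewed as a subspace `𝔸` of `𝕂(X)`. -/
abbrev ASub (𝒜 : Set (Set X)) := {K : KHyper X // K.1 ∈ 𝒜}

end Hyperspace

/-- An ideal of compact proper subsets of a space: closed under finite unions
and under compact subsets. -/
def IsCompactIdealOn {Y : Type*} [TopologicalSpace Y] (ℬ : Set (Set Y)) : Prop :=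
  (∀ B ∈ ℬ, IsCompact B ∧ B ≠ Set.univ) ∧
  (∀ B ∈ ℬ, ∀ C ∈ ℬ, B ∪ C ∈ ℬ) ∧
  (∀ B ∈ ℬ, ∀ C : Set Y, IsCompact C → C ⊆ B → C ∈ ℬ)

/-- `ℬ` witnesses that the ideal `𝒜` of compact subsets of `X` is closed under
`𝒜`-unions: `ℬ` is an ideal of compact subsets of the subspace `𝔸 = 𝒜` of
`𝕂(X)` such that (i) for every `K₀ ∈ 𝒜`, `{K ∈ 𝔸 : K ⊆ K₀} ∈ ℬ`, and
(ii) for every `KK ∈ ℬ`, `⋃ KK ∈ 𝒜`. -/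
def WitnessesAUnions {X : Type*} [TopologicalSpace X] (𝒜 : Set (Set X))
    (ℬ : Set (Set (ASub X 𝒜))) : Prop :=
  IsCompactIdealOn ℬ ∧
  (∀ K₀ ∈ 𝒜, {K : ASub X 𝒜 | K.1.1 ⊆ K₀} ∈ ℬ) ∧
  (∀ KK ∈ ℬ, (⋃ K ∈ KK, (K : ASub X 𝒜).1.1) ∈ 𝒜)

/-- `X^{≤n}`: the disjoint union of `X, X², …, Xⁿ`. -/
abbrev LePow (X : Type*) (n : ℕ) := Σ i : Fin n, (Fin (i.1 + 1) → X)

/-- `X^{<ω}`: the disjoint union of all finite powers `Xⁿ`, `n ≥ 1`. -/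
abbrev FinPows (X : Type*) := Σ n : ℕ, (Fin (n + 1) → X)

/-- `A^{≤n}`: the copy of the disjoint union of `A, A², …, Aⁿ` inside `X^{≤n}`. -/
def lePowSet {X : Type*} (n : ℕ) (A : Set X) : Set (LePow X n) :=
  {p | ∀ j, p.2 j ∈ A}

/-- `A^{<ω}` inside `X^{<ω}`. -/
def finPowsSet {X : Type*} (A : Set X) : Set (FinPows X) :=
  {p | ∀ j, p.2 j ∈ A}

section FinitePointHyperspace

variable {X : Type*} [TopologicalSpace X]

lemma exists_vietoris_nhds {S : Set (KHyper X)} (hS : IsOpen S) {G : KHyper X} (hG : G ∈ S) :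
    ∃ N : X → Set X, (∀ x, IsOpen (N x) ∧ x ∈ N x) ∧
      ∀ K : KHyper X, K.1 ⊆ ⋃ x ∈ G.1, N x → (∀ x ∈ G.1, (K.1 ∩ N x).Nonempty) → K ∈ S := by
  classical
  have hS' : TopologicalSpace.GenerateOpen _ S := hS
  induction hS' with
  | basic s hs =>
    rcases hs with ⟨U, hU, rfl⟩ | ⟨U, hU, rfl⟩
    · refine ⟨fun x => if x ∈ U then U else univ, fun x => ?_, fun K hK _ => ?_⟩
      · by_cases hx : x ∈ U <;> simp [hx, hU]
      · refine hK.trans (iUnion₂_subset fun x hx => ?_)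
        simp [show x ∈ U from hG hx]
    · refine ⟨fun x => if x ∈ U then U else univ, fun x => ?_, fun K _ hK => ?_⟩
      · by_cases hx : x ∈ U <;> simp [hx, hU]
      · obtain ⟨x, hxG, hxU⟩ := hG
        simpa [hxU] using hK x hxG
  | univ => exact ⟨fun _ => univ, fun x => ⟨isOpen_univ, mem_univ x⟩, fun K _ _ => mem_univ K⟩
  | inter s t hs ht ihs iht =>
    obtain ⟨N, hN, hNs⟩ := ihs hs hG.1
    obtain ⟨M, hM, hMt⟩ := iht ht hG.2
    refine ⟨fun x => N x ∩ M x, fun x => ⟨(hN x).1.inter (hM x).1, (hN x).2, (hM x).2⟩,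
      fun K hK hK' => ⟨hNs K ?_ ?_, hMt K ?_ ?_⟩⟩
    · exact hK.trans (iUnion₂_mono fun x _ => inter_subset_left)
    · exact fun x hx => (hK' x hx).mono (inter_subset_inter_right _ inter_subset_left)
    · exact hK.trans (iUnion₂_mono fun x _ => inter_subset_right)
    · exact fun x hx => (hK' x hx).mono (inter_subset_inter_right _ inter_subset_right)
  | sUnion T hT ih =>
    obtain ⟨s, hs, hGs⟩ := hG
    obtain ⟨N, hN, hNs⟩ := ih s hs (hT s hs) hGs
    exact ⟨N, hN, fun K h h' => ⟨s, hs, hNs K h h'⟩⟩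

/-- The set of nonempty finite subsets of `U`, as a subset of `P_fin(X)`. -/
def pfinLower (U : Set X) : Set (PFinH X) := {K | K.1.1 ⊆ U}

lemma isOpen_pfinLower {U : Set X} (hU : IsOpen U) : IsOpen (pfinLower U) :=
  isOpen_induced_iff.2 ⟨{K : KHyper X | K.1 ⊆ U},
    TopologicalSpace.GenerateOpen.basic _ (Or.inl ⟨U, hU, rfl⟩), rfl⟩

/-- A nonempty finite set, as a point of `P_fin(X)`. -/
def pfinMk (F : Set X) (hF : F.Finite) (hne : F.Nonempty) : PFinH X :=
  ⟨⟨F, hF.isCompact, hne⟩, hF⟩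

lemma pfinLower_subset_pfinLower {U V : Set X} (h : pfinLower U ⊆ pfinLower V) : U ⊆ V :=
  fun x hx => h (a := pfinMk {x} (finite_singleton x) (singleton_nonempty x))
    (singleton_subset_iff.2 hx) rfl

lemma pfinLower_ne_univ {U : Set X} (hU : U ≠ univ) : pfinLower U ≠ univ := by
  intro h
  refine hU (univ_subset_iff.1 (pfinLower_subset_pfinLower ?_))
  rw [h]
  exact subset_univ _

lemma finite_pfinLower {F : Set X} (hF : F.Finite) : (pfinLower F).Finite :=
  hF.finite_subsets.preimage (f := fun K : PFinH X => K.1.1)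
    (Subtype.val_injective.comp Subtype.val_injective).injOn

lemma exists_isOpen_pfinLower_subset [T1Space X] [Infinite X] {S : Set (PFinH X)}
    (hS : IsOpen S) {F : Set X} (hF : F.Finite) (hFS : pfinLower F ⊆ S) :
    ∃ U : Set X, IsOpen U ∧ U ≠ univ ∧ F ⊆ U ∧ pfinLower U ⊆ S := by
  obtain ⟨S', hS', rfl⟩ := isOpen_induced_iff.1 hS
  have hex : ∀ G : PFinH X, ∃ N : X → Set X, (∀ x, IsOpen (N x) ∧ x ∈ N x) ∧
      (G ∈ pfinLower F → ∀ K : KHyper X, K.1 ⊆ ⋃ x ∈ G.1.1, N x →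
        (∀ x ∈ G.1.1, (K.1 ∩ N x).Nonempty) → K ∈ S') := by
    intro G
    by_cases hG : G ∈ pfinLower F
    · obtain ⟨N, hN, h⟩ := exists_vietoris_nhds hS' (hFS hG)
      exact ⟨N, hN, fun _ => h⟩
    · exact ⟨fun _ => univ, fun x => ⟨isOpen_univ, mem_univ x⟩, fun h => absurd h hG⟩
  choose N hN hNS using hex
  obtain ⟨p, hp⟩ := hF.exists_notMem
  let M : X → Set X := fun x => ⋂ G ∈ pfinLower F, N G x
  have hM : ∀ x, IsOpen (M x) := fun x =>
    (finite_pfinLower hF).isOpen_biInter fun G _ => (hN G x).1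
  have hxM : ∀ x, x ∈ M x := fun x => mem_iInter₂.2 fun G _ => (hN G x).2
  refine ⟨(⋃ x ∈ F, M x) ∩ {p}ᶜ,
    (isOpen_biUnion fun x _ => hM x).inter isOpen_compl_singleton, ?_, ?_, ?_⟩
  · intro h
    have := h.ge (mem_univ p)
    exact this.2 rfl
  · exact fun x hx => ⟨mem_biUnion hx (hxM x), fun h => hp (h ▸ hx)⟩
  · intro K hK
    have hcov : ∀ y ∈ K.1.1, ∃ x ∈ F, y ∈ M x := fun y hy => by
      simpa using (hK hy).1
    let G₀ : Set X := {x ∈ F | (K.1.1 ∩ M x).Nonempty}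
    have hG₀ : G₀ ⊆ F := fun x hx => hx.1
    have hne : G₀.Nonempty := by
      obtain ⟨y, hy⟩ := K.1.2.2
      obtain ⟨x, hx, hyx⟩ := hcov y hy
      exact ⟨x, hx, y, hy, hyx⟩
    let G : PFinH X := pfinMk G₀ (hF.subset hG₀) hne
    have hG : G ∈ pfinLower F := hG₀
    have hMN : ∀ x, M x ⊆ N G x := fun x => biInter_subset_of_mem hG
    refine hNS G hG K.1 (fun y hy => ?_) fun x hx => ?_
    · obtain ⟨x, hx, hyx⟩ := hcov y hy
      exact mem_biUnion (show x ∈ G.1.1 from ⟨hx, y, hy, hyx⟩) (hMN x hyx)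
    · exact hx.2.mono (inter_subset_inter_right _ (hMN x))

lemma isOmegaCover_of_finite {Y : Type*} [TopologicalSpace Y] {𝒰 : Set (Set Y)}
    (ho : ∀ U ∈ 𝒰, IsOpen U) (hne : ∀ U ∈ 𝒰, U ≠ univ)
    (hfin : ∀ F : Set Y, F.Finite → ∃ U ∈ 𝒰, F ⊆ U) : IsOmegaCover Y 𝒰 := by
  refine ⟨⟨ho, eq_univ_of_forall fun y => ?_, fun h => hne _ h rfl⟩, hfin⟩
  obtain ⟨U, hU, hy⟩ := hfin {y} (finite_singleton y)
  exact ⟨U, hU, hy rfl⟩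

lemma IsNontrivialOpenCover.exists_mem {Y : Type*} [TopologicalSpace Y] {𝒰 : Set (Set Y)}
    (h : IsNontrivialOpenCover Y 𝒰) (y : Y) : ∃ U ∈ 𝒰, y ∈ U :=
  mem_sUnion.1 (h.2.1.ge (mem_univ y))

lemma isNontrivialOpenCover_of_pfinLower {𝒰 : Set (Set X)} {𝒲 : Set (Set (PFinH X))}
    (h𝒰 : IsOmegaCover X 𝒰) (ho : ∀ W ∈ 𝒲, IsOpen W) (hne : univ ∉ 𝒲)
    (h : ∀ U ∈ 𝒰, pfinLower U ⊆ ⋃₀ 𝒲) : IsNontrivialOpenCover (PFinH X) 𝒲 := by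
  refine ⟨ho, eq_univ_of_forall fun K => ?_, hne⟩
  obtain ⟨U, hU, hKU⟩ := h𝒰.2 K.1.1 K.2
  exact h U hU hKU

lemma isOmegaCover_of_pfinLower {𝒰 : Set (Set X)} {𝒲 : Set (Set (PFinH X))}
    (h𝒰 : IsOmegaCover X 𝒰) (ho : ∀ W ∈ 𝒲, IsOpen W) (hne : univ ∉ 𝒲)
    (h : ∀ U ∈ 𝒰, ∃ W ∈ 𝒲, pfinLower U ⊆ W) : IsOmegaCover (PFinH X) 𝒲 := by
  refine isOmegaCover_of_finite ho (fun W hW hW' => hne (hW' ▸ hW)) fun 𝒦 h𝒦 => ?_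
  obtain ⟨U, hU, hKU⟩ := h𝒰.2 (⋃ K ∈ 𝒦, K.1.1) (h𝒦.biUnion fun K _ => K.2)
  obtain ⟨W, hW, hUW⟩ := h U hU
  exact ⟨W, hW, fun K hK =>
    hUW ((subset_biUnion_of_mem (u := fun K : PFinH X => K.1.1) hK).trans hKU)⟩

lemma isOmegaCover_pfinLower_image {𝒰 : Set (Set X)} (h𝒰 : IsOmegaCover X 𝒰) :
    IsOmegaCover (PFinH X) (pfinLower '' 𝒰) := by
  refine isOmegaCover_of_pfinLower h𝒰 ?_ ?_ fun U hU => ⟨_, mem_image_of_mem _ hU, Subset.rfl⟩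
  · rintro _ ⟨U, hU, rfl⟩
    exact isOpen_pfinLower (h𝒰.1.1 U hU)
  · rintro ⟨U, hU, h⟩
    exact pfinLower_ne_univ (fun h' => h𝒰.1.2.2 (h' ▸ hU)) h

lemma isOmegaCover_of_pfinLower_image [Nonempty X] {𝒰 : Set (Set X)} (ho : ∀ U ∈ 𝒰, IsOpen U)
    (hne : univ ∉ 𝒰) (h : ⋃₀ (pfinLower '' 𝒰) = univ) : IsOmegaCover X 𝒰 := by
  refine isOmegaCover_of_finite ho (fun W hW hW' => hne (hW' ▸ hW)) fun F hF => ?_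
  obtain ⟨x⟩ := ‹Nonempty X›
  obtain ⟨_, ⟨U, hU, rfl⟩, hK⟩ :=
    h.ge (mem_univ (pfinMk (insert x F) (hF.insert x) (insert_nonempty x F)))
  exact ⟨U, hU, (subset_insert x F).trans hK⟩

end FinitePointHyperspace

section GameTranslation

variable {ι κ μ : Type*}

lemma LeTwo1.trans {A C : Set (Set ι)} {B D : Set (Set κ)} {E G : Set (Set μ)}
    (h : LeTwo1 A C B D) (h' : LeTwo1 B D E G) : LeTwo1 A C E G :=
  ⟨h'.1 ∘ h.1, h'.2.1 ∘ h.2.1, h'.2.2.1 ∘ h.2.2.1, h'.2.2.2.1 ∘ h.2.2.2.1,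
    h'.2.2.2.2 ∘ h.2.2.2.2⟩

lemma LeTwoFin.trans {A C : Set (Set ι)} {B D : Set (Set κ)} {E G : Set (Set μ)}
    (h : LeTwoFin A C B D) (h' : LeTwoFin B D E G) : LeTwoFin A C E G :=
  ⟨h'.1 ∘ h.1, h'.2.1 ∘ h.2.1, h'.2.2.1 ∘ h.2.2.1, h'.2.2.2.1 ∘ h.2.2.2.1,
    h'.2.2.2.2 ∘ h.2.2.2.2⟩

lemma LeTwo1.antisymm {A C : Set (Set ι)} {B D : Set (Set κ)}
    (h : LeTwo1 A C B D) (h' : LeTwo1 B D A C) : Equiv1 A C B D :=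
  ⟨⟨h.1, h'.1⟩, ⟨h.2.1, h'.2.1⟩, not_iff_not.1 ⟨h.2.2.1, h'.2.2.1⟩,
    not_iff_not.1 ⟨h.2.2.2.1, h'.2.2.2.1⟩, not_iff_not.1 ⟨h.2.2.2.2, h'.2.2.2.2⟩⟩

lemma LeTwoFin.antisymm {A C : Set (Set ι)} {B D : Set (Set κ)}
    (h : LeTwoFin A C B D) (h' : LeTwoFin B D A C) : EquivFin A C B D :=
  ⟨⟨h.1, h'.1⟩, ⟨h.2.1, h'.2.1⟩, not_iff_not.1 ⟨h.2.2.1, h'.2.2.1⟩,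
    not_iff_not.1 ⟨h.2.2.2.1, h'.2.2.2.1⟩, not_iff_not.1 ⟨h.2.2.2.2, h'.2.2.2.2⟩⟩

lemma foldl_ofFn_succ {α β : Type*} (f : β → α → β) (b : β) (x : ℕ → α) (n : ℕ) :
    (List.ofFn fun i : Fin (n + 1) => x i).foldl f b =
      f ((List.ofFn fun i : Fin n => x i).foldl f b) (x n) := by
  rw [List.ofFn_succ_last]
  simp

/-- Translate a sequence of moves into a sequence of moves of another game, where each move is
translated in view of the translated history. -/
def translateHistory {α β : Type*} (φ : List β → α → β) (l : List α) : List β :=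
  l.foldl (fun acc x => acc ++ [φ acc x]) []

lemma translateHistory_ofFn {α β : Type*} (φ : List β → α → β) (x : ℕ → α) (n : ℕ) :
    translateHistory φ (List.ofFn fun i : Fin n => x i) =
      List.ofFn fun i : Fin n =>
        φ (translateHistory φ (List.ofFn fun j : Fin i => x j)) (x i) := by
  induction n with
  | zero => rfl
  | succ n ih =>
    rw [List.ofFn_succ_last (n := n)
      (f := fun i => φ (translateHistory φ (List.ofFn fun j : Fin i => x j)) (x i))]
    unfold translateHistory at ih ⊢
    rw [foldl_ofFn_succ]
    simp only [Fin.val_castSucc, Fin.val_last]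
    rw [← ih]

lemma getLastD_ofFn_succ {α : Type*} (x : ℕ → α) (n : ℕ) (d : α) :
    (List.ofFn fun i : Fin (n + 1) => x i).getLastD d = x n := by
  rw [List.ofFn_succ_last]
  simp

lemma leTwo1_of_translation {A C : Set (Set ι)} {B D : Set (Set κ)}
    (T : Set κ → Set ι) (φ : Set κ → ι → κ) (hT : ∀ b ∈ B, T b ∈ A)
    (hφ : ∀ b ∈ B, ∀ u ∈ T b, φ b u ∈ b)
    (hwin : ∀ b : ℕ → Set κ, (∀ n, b n ∈ B) → ∀ u : ℕ → ι, (∀ n, u n ∈ T (b n)) →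
      range u ∈ C → range (fun n => φ (b n) (u n)) ∈ D) :
    LeTwo1 A C B D := by
  refine ⟨?_, ?_, mt ?_, mt ?_, mt ?_⟩
  · rintro ⟨τ, hτ⟩
    refine ⟨fun b n => φ b (τ (T b) n), fun b hb => ?_⟩
    obtain ⟨h₁, h₂⟩ := hτ (fun n => T (b n)) fun n => hT _ (hb n)
    exact ⟨fun n => hφ _ (hb n) _ (h₁ n), hwin b hb _ h₁ h₂⟩
  · rintro ⟨τ, hτ⟩
    refine ⟨fun l => φ (l.getLastD ∅) (τ (l.map T)), fun b hb => ?_⟩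
    obtain ⟨h₁, h₂⟩ := hτ (fun n => T (b n)) fun n => hT _ (hb n)
    simp only [getLastD_ofFn_succ, List.map_ofFn, Function.comp_def]
    exact ⟨fun n => hφ _ (hb n) _ (h₁ n), hwin b hb _ h₁ h₂⟩
  · rintro ⟨σ, hσ, hw⟩
    refine ⟨fun l => T (σ (translateHistory (fun acc u => φ (σ acc) u) l)),
      fun l => hT _ (hσ _), fun u hu hC => ?_⟩
    refine hw (fun n => φ (σ (translateHistory (fun acc u => φ (σ acc) u)
      (List.ofFn fun i : Fin n => u i))) (u n)) (fun n => ?_)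
      (hwin _ (fun n => hσ _) u hu hC)
    rw [← translateHistory_ofFn (fun acc u => φ (σ acc) u) u n]
    exact hφ _ (hσ _) _ (hu n)
  · rintro ⟨σ, hσ, hw⟩
    exact ⟨fun n => T (σ n), fun n => hT _ (hσ n), fun u hu hC =>
      hw _ (fun n => hφ _ (hσ n) _ (hu n)) (hwin σ hσ u hu hC)⟩
  · rintro ⟨b, hb, hw⟩
    exact ⟨T b, hT b hb, fun u hu hC =>
      hw _ (fun n => hφ _ hb _ (hu n)) (hwin (fun _ => b) (fun _ => hb) u hu hC)⟩

lemma leTwoFin_of_translation {A C : Set (Set ι)} {B D : Set (Set κ)}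
    (T : Set κ → Set ι) (φ : Set κ → ι → Set κ) (hT : ∀ b ∈ B, T b ∈ A)
    (hφ : ∀ b ∈ B, ∀ u ∈ T b, φ b u ⊆ b ∧ (φ b u).Finite)
    (hwin : ∀ b : ℕ → Set κ, (∀ n, b n ∈ B) → ∀ F : ℕ → Set ι,
      (∀ n, F n ⊆ T (b n) ∧ (F n).Finite) →
      (⋃ n, F n) ∈ C → (⋃ n, ⋃ u ∈ F n, φ (b n) u) ∈ D) :
    LeTwoFin A C B D := by
  have hφ' : ∀ b ∈ B, ∀ F : Set ι, F ⊆ T b ∧ F.Finite →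
      (⋃ u ∈ F, φ b u) ⊆ b ∧ (⋃ u ∈ F, φ b u).Finite := fun b hb F hF =>
    ⟨iUnion₂_subset fun u hu => (hφ b hb u (hF.1 hu)).1,
      hF.2.biUnion fun u hu => (hφ b hb u (hF.1 hu)).2⟩
  refine ⟨?_, ?_, mt ?_, mt ?_, mt ?_⟩
  · rintro ⟨τ, hτ⟩
    refine ⟨fun b n => ⋃ u ∈ τ (T b) n, φ b u, fun b hb => ?_⟩
    obtain ⟨h₁, h₂⟩ := hτ (fun n => T (b n)) fun n => hT _ (hb n)
    exact ⟨fun n => hφ' _ (hb n) _ (h₁ n), hwin b hb _ h₁ h₂⟩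
  · rintro ⟨τ, hτ⟩
    refine ⟨fun l => ⋃ u ∈ τ (l.map T), φ (l.getLastD ∅) u, fun b hb => ?_⟩
    obtain ⟨h₁, h₂⟩ := hτ (fun n => T (b n)) fun n => hT _ (hb n)
    simp only [getLastD_ofFn_succ, List.map_ofFn, Function.comp_def]
    exact ⟨fun n => hφ' _ (hb n) _ (h₁ n), hwin b hb _ h₁ h₂⟩
  · rintro ⟨σ, hσ, hw⟩
    let tr : List (Set κ) → Set ι → Set κ := fun acc F => ⋃ u ∈ F, φ (σ acc) u
    refine ⟨fun l => T (σ (translateHistory tr l)), fun l => hT _ (hσ _), fun F hF hC => ?_⟩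
    let b : ℕ → Set κ := fun n => σ (translateHistory tr (List.ofFn fun i : Fin n => F i))
    refine hw (fun n => tr (translateHistory tr (List.ofFn fun i : Fin n => F i)) (F n))
      (fun n => ?_) (hwin b (fun n => hσ _) F hF hC)
    rw [← translateHistory_ofFn tr F n]
    exact hφ' _ (hσ _) _ (hF n)
  · rintro ⟨σ, hσ, hw⟩
    exact ⟨fun n => T (σ n), fun n => hT _ (hσ n), fun F hF hC =>
      hw _ (fun n => hφ' _ (hσ n) _ (hF n)) (hwin σ hσ F hF hC)⟩
  · rintro ⟨b, hb, hw⟩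
    exact ⟨T b, hT b hb, fun F hF hC =>
      hw _ (fun n => hφ' _ hb _ (hF n)) (hwin (fun _ => b) (fun _ => hb) F hF hC)⟩

/-- A strategy for Two that remembers a state and updates it after every move of One. -/
lemma twoWin1_of_state {A B : Set (Set ι)} {S : Type*} (s₀ : S) (step : S → Set ι → S)
    (resp : S → Set ι → ι)
    (h : ∀ a : ℕ → Set ι, (∀ n, a n ∈ A) → ∀ st : ℕ → S, st 0 = s₀ →
      (∀ n, st (n + 1) = step (st n) (a n)) →
      (∀ n, resp (st n) (a n) ∈ a n) ∧ range (fun n => resp (st n) (a n)) ∈ B) :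
    TwoWin1 A B := by
  refine ⟨fun l => resp (l.dropLast.foldl step s₀) (l.getLastD ∅), fun a ha => ?_⟩
  have hd : ∀ n, (List.ofFn fun i : Fin (n + 1) => a i).dropLast =
      List.ofFn fun i : Fin n => a i := fun n => by
    rw [List.ofFn_succ_last]
    simp
  simp only [getLastD_ofFn_succ, hd]
  exact h a ha (fun n => (List.ofFn fun i : Fin n => a i).foldl step s₀) rfl
    fun n => foldl_ofFn_succ _ _ _ _

lemma exists_limit_of_prefix_chain {α : Type*} (h : ℕ → List α) (hmono : ∀ n, h n <+: h (n + 1))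
    (hunb : ∀ k, ∃ n, k < (h n).length) :
    ∃ a : ℕ → α, ∀ n, h n = List.ofFn fun i : Fin (h n).length => a i := by
  have hle : ∀ m n, m ≤ n → h m <+: h n := fun m n hmn =>
    Nat.le_induction (List.prefix_refl _) (fun n _ ih => ih.trans (hmono n)) n hmn
  choose N hN using hunb
  refine ⟨fun k => (h (N k))[k]'(hN k), fun n => List.ext_getElem (by simp) fun i hi _ => ?_⟩
  simp only [List.getElem_ofFn]
  rcases le_total n (N i) with hni | hni
  · exact (hle _ _ hni).getElem hi
  · exact ((hle _ _ hni).getElem (hN i)).symm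

end GameTranslation

section SimpleReductions

variable {X : Type*} [TopologicalSpace X]

/-- The proper open sets `U` such that the nonempty finite subsets of `U` all belong to a single
member of `𝒲`. -/
def refiningOpens (𝒲 : Set (Set (PFinH X))) : Set (Set X) :=
  {U | IsOpen U ∧ U ≠ univ ∧ ∃ W ∈ 𝒲, pfinLower U ⊆ W}

lemma isOmegaCover_refiningOpens [T1Space X] [Infinite X] {𝒲 : Set (Set (PFinH X))}
    (h𝒲 : IsOmegaCover (PFinH X) 𝒲) : IsOmegaCover X (refiningOpens 𝒲) := by
  refine isOmegaCover_of_finite (fun U hU => hU.1) (fun U hU => hU.2.1) fun F hF => ?_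
  obtain ⟨W, hW, hFW⟩ := h𝒲.2 _ (finite_pfinLower hF)
  obtain ⟨U, hUo, hUne, hFU, hUW⟩ := exists_isOpen_pfinLower_subset (h𝒲.1.1 W hW) hF hFW
  exact ⟨U, ⟨hUo, hUne, W, hW, hUW⟩, hFU⟩

/-- The proper open sets `U` such that the nonempty finite subsets of `U` are covered by finitely
many members of `𝒲`. -/
def finitelyRefiningOpens (𝒲 : Set (Set (PFinH X))) : Set (Set X) :=
  {U | IsOpen U ∧ U ≠ univ ∧ ∃ 𝒱 ⊆ 𝒲, 𝒱.Finite ∧ pfinLower U ⊆ ⋃₀ 𝒱}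

lemma isOmegaCover_finitelyRefiningOpens [T1Space X] [Infinite X] {𝒲 : Set (Set (PFinH X))}
    (h𝒲 : IsNontrivialOpenCover (PFinH X) 𝒲) : IsOmegaCover X (finitelyRefiningOpens 𝒲) := by
  refine isOmegaCover_of_finite (fun U hU => hU.1) (fun U hU => hU.2.1) fun F hF => ?_
  choose w hw hmem using h𝒲.exists_mem
  have hsub : w '' pfinLower F ⊆ 𝒲 := by
    rintro _ ⟨G, _, rfl⟩
    exact hw G
  obtain ⟨U, hUo, hUne, hFU, hUW⟩ := exists_isOpen_pfinLower_subset
    (isOpen_sUnion fun W hW => h𝒲.1 W (hsub hW)) hF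
    (fun G hG => mem_sUnion.2 ⟨w G, mem_image_of_mem w hG, hmem G⟩)
  exact ⟨U, ⟨hUo, hUne, _, hsub, (finite_pfinLower hF).image w, hUW⟩, hFU⟩

lemma leTwo1_omega_pfin_omega [T1Space X] [Infinite X] :
    LeTwo1 (omegaCovers X) (omegaCovers X) (omegaCovers (PFinH X)) (omegaCovers (PFinH X)) := by
  have hex : ∀ (𝒲 : Set (Set (PFinH X))) (U : Set X), ∃ W : Set (PFinH X),
      U ∈ refiningOpens 𝒲 → W ∈ 𝒲 ∧ pfinLower U ⊆ W := by
    intro 𝒲 U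
    by_cases h : U ∈ refiningOpens 𝒲
    · exact h.2.2.imp fun W hW _ => hW
    · exact ⟨∅, fun h' => absurd h' h⟩
  choose φ hφ using hex
  refine leTwo1_of_translation refiningOpens φ (fun 𝒲 h𝒲 => isOmegaCover_refiningOpens h𝒲)
    (fun 𝒲 _ U hU => (hφ 𝒲 U hU).1) fun 𝒲 h𝒲 U hU hω => ?_
  refine isOmegaCover_of_pfinLower hω ?_ ?_ ?_
  · rintro _ ⟨n, rfl⟩
    exact (h𝒲 n).1.1 _ (hφ _ _ (hU n)).1
  · rintro ⟨n, hn⟩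
    exact (h𝒲 n).1.2.2 (hn ▸ (hφ _ _ (hU n)).1)
  · rintro _ ⟨n, rfl⟩
    exact ⟨_, ⟨n, rfl⟩, (hφ _ _ (hU n)).2⟩

lemma leTwoFin_omega_pfin_omega [T1Space X] [Infinite X] :
    LeTwoFin (omegaCovers X) (omegaCovers X) (omegaCovers (PFinH X)) (omegaCovers (PFinH X)) := by
  have hex : ∀ (𝒲 : Set (Set (PFinH X))) (U : Set X), ∃ W : Set (PFinH X),
      U ∈ refiningOpens 𝒲 → W ∈ 𝒲 ∧ pfinLower U ⊆ W := by
    intro 𝒲 U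
    by_cases h : U ∈ refiningOpens 𝒲
    · exact h.2.2.imp fun W hW _ => hW
    · exact ⟨∅, fun h' => absurd h' h⟩
  choose φ hφ using hex
  refine leTwoFin_of_translation refiningOpens (fun 𝒲 U => {φ 𝒲 U})
    (fun 𝒲 h𝒲 => isOmegaCover_refiningOpens h𝒲)
    (fun 𝒲 _ U hU => ⟨singleton_subset_iff.2 (hφ 𝒲 U hU).1, finite_singleton _⟩)
    fun 𝒲 h𝒲 F hF hω => ?_
  have key : ∀ W ∈ ⋃ n, ⋃ U ∈ F n, {φ (𝒲 n) U}, ∃ n, W ∈ 𝒲 n := by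
    simp only [mem_iUnion, mem_singleton_iff]
    rintro _ ⟨n, U, hU, rfl⟩
    exact ⟨n, (hφ _ _ ((hF n).1 hU)).1⟩
  refine isOmegaCover_of_pfinLower hω ?_ ?_ ?_
  · intro W hW
    obtain ⟨n, hn⟩ := key W hW
    exact (h𝒲 n).1.1 _ hn
  · intro hW
    obtain ⟨n, hn⟩ := key _ hW
    exact (h𝒲 n).1.2.2 hn
  · intro U hU
    obtain ⟨n, hn⟩ := mem_iUnion.1 hU
    exact ⟨φ (𝒲 n) U, mem_iUnion.2 ⟨n, mem_biUnion hn rfl⟩, (hφ _ _ ((hF n).1 hn)).2⟩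

lemma leTwoFin_omega_pfin_open [T1Space X] [Infinite X] :
    LeTwoFin (omegaCovers X) (omegaCovers X) (openCovers (PFinH X)) (openCovers (PFinH X)) := by
  have hex : ∀ (𝒲 : Set (Set (PFinH X))) (U : Set X), ∃ 𝒱 : Set (Set (PFinH X)),
      U ∈ finitelyRefiningOpens 𝒲 → 𝒱 ⊆ 𝒲 ∧ 𝒱.Finite ∧ pfinLower U ⊆ ⋃₀ 𝒱 := by
    intro 𝒲 U
    by_cases h : U ∈ finitelyRefiningOpens 𝒲
    · exact h.2.2.imp fun W hW _ => hW
    · exact ⟨∅, fun h' => absurd h' h⟩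
  choose φ hφ using hex
  refine leTwoFin_of_translation finitelyRefiningOpens φ
    (fun 𝒲 h𝒲 => isOmegaCover_finitelyRefiningOpens h𝒲)
    (fun 𝒲 _ U hU => ⟨(hφ 𝒲 U hU).1, (hφ 𝒲 U hU).2.1⟩) fun 𝒲 h𝒲 F hF hω => ?_
  have key : ∀ W ∈ ⋃ n, ⋃ U ∈ F n, φ (𝒲 n) U, ∃ n, W ∈ 𝒲 n := by
    simp only [mem_iUnion]
    rintro W ⟨n, U, hU, hW⟩
    exact ⟨n, (hφ _ _ ((hF n).1 hU)).1 hW⟩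
  refine isNontrivialOpenCover_of_pfinLower hω ?_ ?_ ?_
  · intro W hW
    obtain ⟨n, hn⟩ := key W hW
    exact (h𝒲 n).1 _ hn
  · intro hW
    obtain ⟨n, hn⟩ := key _ hW
    exact (h𝒲 n).2.2 hn
  · intro U hU
    obtain ⟨n, hn⟩ := mem_iUnion.1 hU
    refine (hφ _ _ ((hF n).1 hn)).2.2.trans (sUnion_subset_sUnion ?_)
    exact (subset_biUnion_of_mem (u := fun U => φ (𝒲 n) U) hn).trans
      (subset_iUnion (fun n => ⋃ U ∈ F n, φ (𝒲 n) U) n)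

lemma image_pfinLower_range_invFunOn {𝒰 : ℕ → Set (Set X)} {W : ℕ → Set (PFinH X)}
    (hW : ∀ n, W n ∈ pfinLower '' 𝒰 n) :
    pfinLower '' range (fun n => Function.invFunOn pfinLower (𝒰 n) (W n)) = range W := by
  rw [← range_comp]
  exact congrArg range (funext fun n => Function.invFunOn_eq (hW n))

lemma leTwo1_pfin_omega [Nonempty X] {A C : Set (Set (Set (PFinH X)))}
    (hA : omegaCovers (PFinH X) ⊆ A) (hC : C ⊆ openCovers (PFinH X)) :
    LeTwo1 A C (omegaCovers X) (omegaCovers X) := by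
  refine leTwo1_of_translation (fun 𝒰 => pfinLower '' 𝒰)
    (fun 𝒰 W => Function.invFunOn pfinLower 𝒰 W)
    (fun 𝒰 h𝒰 => hA (isOmegaCover_pfinLower_image h𝒰))
    (fun 𝒰 _ W hW => Function.invFunOn_mem hW) fun 𝒰 h𝒰 W hW hcov => ?_
  refine isOmegaCover_of_pfinLower_image ?_ ?_ ?_
  · rintro _ ⟨n, rfl⟩
    exact (h𝒰 n).1.1 _ (Function.invFunOn_mem (hW n))
  · rintro ⟨n, hn⟩
    exact (h𝒰 n).1.2.2 (hn ▸ Function.invFunOn_mem (hW n))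
  · rw [image_pfinLower_range_invFunOn hW]
    exact (hC hcov).2.1

lemma leTwoFin_pfin_omega [Nonempty X] {A C : Set (Set (Set (PFinH X)))}
    (hA : omegaCovers (PFinH X) ⊆ A) (hC : C ⊆ openCovers (PFinH X)) :
    LeTwoFin A C (omegaCovers X) (omegaCovers X) := by
  refine leTwoFin_of_translation (fun 𝒰 => pfinLower '' 𝒰)
    (fun 𝒰 W => {Function.invFunOn pfinLower 𝒰 W})
    (fun 𝒰 h𝒰 => hA (isOmegaCover_pfinLower_image h𝒰))
    (fun 𝒰 _ W hW => ⟨singleton_subset_iff.2 (Function.invFunOn_mem hW), finite_singleton _⟩)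
    fun 𝒰 h𝒰 F hF hcov => ?_
  have key : ∀ U ∈ ⋃ n, ⋃ W ∈ F n, {Function.invFunOn pfinLower (𝒰 n) W}, ∃ n, U ∈ 𝒰 n := by
    simp only [mem_iUnion, mem_singleton_iff]
    rintro _ ⟨n, W, hW, rfl⟩
    exact ⟨n, Function.invFunOn_mem ((hF n).1 hW)⟩
  refine isOmegaCover_of_pfinLower_image ?_ ?_ ?_
  · intro U hU
    obtain ⟨n, hn⟩ := key U hU
    exact (h𝒰 n).1.1 _ hn
  · intro hU
    obtain ⟨n, hn⟩ := key _ hU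
    exact (h𝒰 n).1.2.2 hn
  · refine univ_subset_iff.1 ((hC hcov).2.1.ge.trans (sUnion_subset_sUnion fun W hW => ?_))
    obtain ⟨n, hn⟩ := mem_iUnion.1 hW
    exact ⟨Function.invFunOn pfinLower (𝒰 n) W, mem_iUnion.2 ⟨n, mem_biUnion hn rfl⟩,
      Function.invFunOn_eq ((hF n).1 hn)⟩

end SimpleReductions

section SingleSelection

variable {X : Type*} [TopologicalSpace X]

lemma ofFn_prefix_ofFn {α : Type*} (a : ℕ → α) {m n : ℕ} (hmn : m ≤ n) :
    (List.ofFn fun i : Fin m => a i) <+: List.ofFn fun i : Fin n => a i := by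
  induction n, hmn using Nat.le_induction with
  | base => exact List.prefix_refl _
  | succ n _ ih =>
    rw [List.ofFn_succ_last]
    exact ih.trans (List.prefix_append _ _)

lemma exists_selector (Y : Type*) [TopologicalSpace Y] :
    ∃ pick : Set (Set Y) → Y → Set Y,
      ∀ 𝒲, IsNontrivialOpenCover Y 𝒲 → ∀ y, pick 𝒲 y ∈ 𝒲 ∧ y ∈ pick 𝒲 y := by
  have hex : ∀ (𝒲 : Set (Set Y)) (y : Y), ∃ W, IsNontrivialOpenCover Y 𝒲 → W ∈ 𝒲 ∧ y ∈ W := by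
    intro 𝒲 y
    by_cases h : IsNontrivialOpenCover Y 𝒲
    · exact (h.exists_mem y).imp fun W hW _ => hW
    · exact ⟨∅, fun h' => absurd h' h⟩
  choose pick hpick using hex
  exact ⟨pick, fun 𝒲 h y => hpick 𝒲 y h⟩

/-- If `τ` selects a member from every ω-cover, then all proper open sets containing a suitable
finite set are selected from some ω-cover. -/
lemma exists_finite_forall_selected [Nonempty X] {τ : Set (Set X) → Set X}
    (hτ : ∀ 𝒱, IsOmegaCover X 𝒱 → τ 𝒱 ∈ 𝒱) :
    ∃ F : Set X, F.Finite ∧ F.Nonempty ∧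
      ∀ U, IsOpen U → U ≠ univ → F ⊆ U → ∃ 𝒱, IsOmegaCover X 𝒱 ∧ τ 𝒱 = U := by
  by_contra! hcon
  obtain ⟨x⟩ := ‹Nonempty X›
  have h𝒱 : IsOmegaCover X
      {U | IsOpen U ∧ U ≠ univ ∧ ∀ 𝒱, IsOmegaCover X 𝒱 → τ 𝒱 ≠ U} := by
    refine isOmegaCover_of_finite (fun U hU => hU.1) (fun U hU => hU.2.1) fun F hF => ?_
    obtain ⟨U, ho, hne, hFU, hU⟩ := hcon (insert x F) (hF.insert x) (insert_nonempty x F)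
    exact ⟨U, ⟨ho, hne, hU⟩, (subset_insert x F).trans hFU⟩
  exact (hτ _ h𝒱).2.2 _ h𝒱 rfl

lemma TwoMarkov1.omega_pfin_open [T1Space X] [Infinite X]
    (h : TwoMarkov1 (omegaCovers X) (omegaCovers X)) :
    TwoMarkov1 (openCovers (PFinH X)) (openCovers (PFinH X)) := by
  obtain ⟨τ, hτ⟩ := h
  choose F hF hFne hFτ using fun n => exists_finite_forall_selected (τ := fun 𝒱 => τ 𝒱 n)
    fun 𝒱 h𝒱 => (hτ (fun _ => 𝒱) fun _ => h𝒱).1 n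
  obtain ⟨e, he⟩ := (countable_iUnion fun n => (finite_pfinLower (hF n)).countable).exists_eq_range
    ⟨pfinMk (F 0) (hF 0) (hFne 0), mem_iUnion.2 ⟨0, Subset.rfl⟩⟩
  obtain ⟨pick, hpick⟩ := exists_selector (PFinH X)
  refine ⟨fun 𝒲 k => pick 𝒲 (e k), fun 𝒲 h𝒲 => ?_⟩
  have hp := fun k => hpick (𝒲 k) (h𝒲 k) (e k)
  refine ⟨fun k => (hp k).1, ?_⟩
  have ho : ∀ W ∈ range fun k => pick (𝒲 k) (e k), IsOpen W := by
    rintro _ ⟨k, rfl⟩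
    exact (h𝒲 k).1 _ (hp k).1
  have hsub : ∀ n, pfinLower (F n) ⊆ ⋃₀ range fun k => pick (𝒲 k) (e k) := by
    intro n G hG
    obtain ⟨k, rfl⟩ := he.le (mem_iUnion.2 ⟨n, hG⟩)
    exact mem_sUnion.2 ⟨_, ⟨k, rfl⟩, (hp k).2⟩
  choose U hUo hUne hFU hU using fun n =>
    exists_isOpen_pfinLower_subset (isOpen_sUnion ho) (hF n) (hsub n)
  choose 𝒱 h𝒱 hτU using fun n => hFτ n (U n) (hUo n) (hUne n) (hFU n)
  refine isNontrivialOpenCover_of_pfinLower (hτ 𝒱 h𝒱).2 ho ?_ ?_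
  · rintro ⟨k, hk⟩
    exact (h𝒲 k).2.2 (hk ▸ (hp k).1)
  · rintro _ ⟨n, rfl⟩
    exact (congrArg pfinLower (hτU n)).le.trans (hU n)

lemma TwoWin1.omega_pfin_open [T1Space X] [Infinite X]
    (h : TwoWin1 (omegaCovers X) (omegaCovers X)) :
    TwoWin1 (openCovers (PFinH X)) (openCovers (PFinH X)) := by
  obtain ⟨τ, hτ⟩ := h
  have hleg : ∀ h : List (Set (Set X)), (∀ 𝒱 ∈ h, IsOmegaCover X 𝒱) →
      ∀ 𝒱, IsOmegaCover X 𝒱 → τ (h ++ [𝒱]) ∈ 𝒱 := by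
    intro h hh 𝒱 h𝒱
    have ha : ∀ n, IsOmegaCover X (h.getD n 𝒱) := fun n => by
      rcases lt_or_ge n h.length with hn | hn
      · rw [List.getD_eq_getElem _ _ hn]
        exact hh _ (List.getElem_mem hn)
      · rwa [List.getD_eq_default _ _ hn]
    have := (hτ (fun n => h.getD n 𝒱) ha).1 h.length
    rw [List.ofFn_succ_last] at this
    have heq : (List.ofFn fun i : Fin h.length => h.getD i 𝒱) = h :=
      List.ext_getElem (by simp) fun i hi hi' => by simp
    simpa [heq] using this
  have hexF : ∀ h : List (Set (Set X)), ∃ F : Set X, F.Finite ∧ F.Nonempty ∧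
      ((∀ 𝒱 ∈ h, IsOmegaCover X 𝒱) → ∀ U, IsOpen U → U ≠ univ → F ⊆ U →
        ∃ 𝒱, IsOmegaCover X 𝒱 ∧ τ (h ++ [𝒱]) = U) := by
    intro h
    by_cases hh : ∀ 𝒱 ∈ h, IsOmegaCover X 𝒱
    · obtain ⟨F, hF, hne, hFτ⟩ := exists_finite_forall_selected (hleg h hh)
      exact ⟨F, hF, hne, fun _ => hFτ⟩
    · obtain ⟨x⟩ := (inferInstance : Nonempty X)
      exact ⟨{x}, finite_singleton x, singleton_nonempty x, fun h' => absurd h' hh⟩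
  choose F hF hFne hFτ using hexF
  have hexpt : ∀ (h : List (Set (Set X))) (S : Set (PFinH X)), ∃ G ∈ pfinLower (F h),
      ¬ pfinLower (F h) ⊆ S → G ∉ S := by
    intro h S
    by_cases hS : pfinLower (F h) ⊆ S
    · exact ⟨pfinMk (F h) (hF h) (hFne h), Subset.rfl, fun h' => absurd hS h'⟩
    · obtain ⟨G, hG, hGS⟩ := not_subset.1 hS
      exact ⟨G, hG, fun _ => hGS⟩
  choose pt hptF hptS using hexpt
  have hexadv : ∀ (h : List (Set (Set X))) (S : Set (PFinH X)), ∃ h' : List (Set (Set X)),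
      (¬ pfinLower (F h) ⊆ S → h' = h) ∧
      (pfinLower (F h) ⊆ S → IsOpen S → (∀ 𝒱 ∈ h, IsOmegaCover X 𝒱) →
        ∃ 𝒱, IsOmegaCover X 𝒱 ∧ h' = h ++ [𝒱] ∧ pfinLower (τ (h ++ [𝒱])) ⊆ S) := by
    intro h S
    by_cases hS : pfinLower (F h) ⊆ S ∧ IsOpen S ∧ ∀ 𝒱 ∈ h, IsOmegaCover X 𝒱
    · obtain ⟨U, hUo, hUne, hFU, hU⟩ := exists_isOpen_pfinLower_subset hS.2.1 (hF h) hS.1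
      obtain ⟨𝒱, h𝒱, hτU⟩ := hFτ h hS.2.2 U hUo hUne hFU
      exact ⟨h ++ [𝒱], fun h' => absurd hS.1 h', fun _ _ _ => ⟨𝒱, h𝒱, rfl, hτU.symm ▸ hU⟩⟩
    · exact ⟨h, fun _ => rfl, fun h₁ h₂ h₃ => absurd ⟨h₁, h₂, h₃⟩ hS⟩
  choose adv hadv_stay hadv using hexadv
  obtain ⟨pick, hpick⟩ := exists_selector (PFinH X)
  refine twoWin1_of_state (S := List (Set (Set X)) × Set (PFinH X)) ([], ∅)
    (fun s 𝒲 => (adv s.1 (s.2 ∪ pick 𝒲 (pt s.1 s.2)), s.2 ∪ pick 𝒲 (pt s.1 s.2)))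
    (fun s 𝒲 => pick 𝒲 (pt s.1 s.2)) fun 𝒲 h𝒲 st h0 hstep => ?_
  have hp := fun n => hpick (𝒲 n) (h𝒲 n) (pt (st n).1 (st n).2)
  refine ⟨fun n => (hp n).1, ?_⟩
  set W : ℕ → Set (PFinH X) := fun n => pick (𝒲 n) (pt (st n).1 (st n).2) with hWdef
  have hS : ∀ n, (st (n + 1)).2 = (st n).2 ∪ W n := fun n => by rw [hstep]
  have hh : ∀ n, (st (n + 1)).1 = adv (st n).1 (st (n + 1)).2 := fun n => by rw [hstep]
  have hWo : ∀ n, IsOpen (W n) := fun n => (h𝒲 n).1 _ (hp n).1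
  have hSo : ∀ n, IsOpen (st n).2 := fun n => by
    induction n with
    | zero => simp [h0]
    | succ n ih => exact hS n ▸ ih.union (hWo n)
  have hSW : ∀ n, (st n).2 ⊆ ⋃₀ range W := fun n => by
    induction n with
    | zero => simp [h0]
    | succ n ih => exact hS n ▸ union_subset ih (subset_sUnion_of_mem ⟨n, rfl⟩)
  have hlegal : ∀ n, ∀ 𝒱 ∈ (st n).1, IsOmegaCover X 𝒱 := fun n => by
    induction n with
    | zero => simp [h0]
    | succ n ih =>
      by_cases hsub : pfinLower (F (st n).1) ⊆ (st (n + 1)).2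
      · obtain ⟨𝒱, h𝒱, heq, -⟩ := hadv _ _ hsub (hSo _) ih
        rw [hh, heq]
        intro 𝒱' h𝒱'
        rcases List.mem_append.1 h𝒱' with h' | h'
        · exact ih _ h'
        · exact List.mem_singleton.1 h' ▸ h𝒱
      · rw [hh, hadv_stay _ _ hsub]
        exact ih
  have hcases : ∀ n, (¬ pfinLower (F (st n).1) ⊆ (st (n + 1)).2 ∧ (st (n + 1)).1 = (st n).1) ∨
      ∃ 𝒱, (st (n + 1)).1 = (st n).1 ++ [𝒱] ∧
        pfinLower (τ ((st n).1 ++ [𝒱])) ⊆ (st (n + 1)).2 := fun n => by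
    by_cases hsub : pfinLower (F (st n).1) ⊆ (st (n + 1)).2
    · obtain ⟨𝒱, -, heq, h'⟩ := hadv _ _ hsub (hSo _) (hlegal n)
      exact Or.inr ⟨𝒱, (hh n).trans heq, h'⟩
    · exact Or.inl ⟨hsub, (hh n).trans (hadv_stay _ _ hsub)⟩
  have hcov : ∀ n l 𝒱, l ++ [𝒱] <+: (st n).1 → pfinLower (τ (l ++ [𝒱])) ⊆ ⋃₀ range W := by
    intro n
    induction n with
    | zero => simp [h0]
    | succ n ih =>
      intro l 𝒱 hl
      rcases hcases n with ⟨-, heq⟩ | ⟨𝒱', heq, h'⟩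
      · exact ih l 𝒱 (heq ▸ hl)
      · rw [heq, List.prefix_concat_iff] at hl
        rcases hl with hl | hl
        · exact hl ▸ h'.trans (hSW _)
        · exact ih l 𝒱 hl
  have hchain : ∀ n, (st n).1 <+: (st (n + 1)).1 := fun n => by
    rcases hcases n with ⟨-, heq⟩ | ⟨𝒱, heq, -⟩
    · exact heq ▸ List.prefix_refl _
    · exact heq ▸ List.prefix_append _ _
  have hprogress : ∀ k n, (pfinLower (F (st n).1) \ (st n).2).ncard ≤ k →
      ∃ m, (st n).1.length < (st m).1.length := by
    intro k
    induction k with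
    | zero =>
      intro n hn
      rcases hcases n with ⟨hsub, -⟩ | ⟨𝒱, heq, -⟩
      · rw [Nat.le_zero, ncard_eq_zero ((finite_pfinLower (hF _)).sdiff), sdiff_eq_empty] at hn
        exact absurd (hn.trans (hS n ▸ subset_union_left)) hsub
      · exact ⟨n + 1, by simp [heq]⟩
    | succ k ih =>
      intro n hn
      rcases hcases n with ⟨hsub, heq⟩ | ⟨𝒱, heq, -⟩
      · rw [← heq]
        refine ih (n + 1) (Nat.lt_succ_iff.1 (lt_of_lt_of_le ?_ hn))
        rw [heq]
        refine ncard_lt_ncard (ssubset_iff_exists.2 ⟨?_, pt (st n).1 (st n).2, ⟨hptF _ _, ?_⟩, ?_⟩)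
          (finite_pfinLower (hF _)).sdiff
        · exact sdiff_subset_sdiff_right (hS n ▸ subset_union_left)
        · exact hptS _ _ fun h' => hsub (h'.trans (hS n ▸ subset_union_left))
        · exact fun h' => h'.2 (hS n ▸ Or.inr (hp n).2)
      · exact ⟨n + 1, by simp [heq]⟩
  have hunb : ∀ k, ∃ n, k < (st n).1.length := fun k => by
    induction k with
    | zero => exact (hprogress _ 0 le_rfl).imp fun m hm => Nat.zero_lt_of_lt hm
    | succ k ih =>
      obtain ⟨n, hn⟩ := ih
      exact (hprogress _ n le_rfl).imp fun m hm => lt_of_le_of_lt hn hm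
  obtain ⟨a, ha⟩ := exists_limit_of_prefix_chain (fun n => (st n).1) hchain hunb
  have hpre : ∀ k, ∃ n, (List.ofFn fun i : Fin (k + 1) => a i) <+: (st n).1 := fun k => by
    obtain ⟨n, hn⟩ := hunb k
    exact ⟨n, (ofFn_prefix_ofFn a hn).trans (ha n ▸ List.prefix_refl _)⟩
  have haΩ : ∀ k, IsOmegaCover X (a k) := fun k => by
    obtain ⟨n, hn⟩ := hpre k
    exact hlegal n _ (hn.subset (List.mem_ofFn.2 ⟨Fin.last k, rfl⟩))
  refine isNontrivialOpenCover_of_pfinLower (hτ a haΩ).2 ?_ ?_ ?_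
  · rintro _ ⟨n, rfl⟩
    exact hWo n
  · rintro ⟨n, hn⟩
    exact (h𝒲 n).2.2 (hn ▸ (hp n).1)
  · rintro _ ⟨k, rfl⟩
    obtain ⟨n, hn⟩ := hpre k
    dsimp only
    rw [List.ofFn_succ_last] at hn ⊢
    exact hcov n _ _ hn

/-- The list `w` continues the run `h` of Two's moves legally against the strategy `σ` for One. -/
def LegalContinuation {ι : Type*} (σ : List ι → Set ι) (h w : List ι) : Prop :=
  ∀ l x, l ++ [x] <+: w → x ∈ σ (h ++ l)

lemma LegalContinuation.concat {ι : Type*} {σ : List ι → Set ι} {h w : List ι}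
    (hw : LegalContinuation σ h w) {x : ι} (hx : x ∈ σ (h ++ w)) :
    LegalContinuation σ h (w ++ [x]) := by
  intro l y hl
  rcases List.prefix_concat_iff.1 hl with heq | hl
  · obtain ⟨rfl, hxy⟩ := List.append_inj' heq rfl
    rw [List.singleton_inj.1 hxy]
    exact hx
  · exact hw l y hl

lemma LegalContinuation.append {ι : Type*} {σ : List ι → Set ι} {h w : List ι}
    (hh : LegalContinuation σ [] h) (hw : LegalContinuation σ h w) :
    LegalContinuation σ [] (h ++ w) := by
  intro l x hl
  rcases List.prefix_or_prefix_of_prefix hl (List.prefix_append h w) with h' | h'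
  · exact hh l x h'
  · rcases List.prefix_concat_iff.1 h' with rfl | ⟨t, rfl⟩
    · exact hh l x (List.prefix_refl _)
    · rw [List.append_assoc, List.prefix_append_right_inj] at hl
      exact hw t x hl

lemma exists_legalContinuation {Y : Type*} [TopologicalSpace Y] {σ : List (Set Y) → Set (Set Y)}
    (hσ : ∀ h, IsNontrivialOpenCover Y (σ h)) (h : List (Set Y)) {𝒦 : Set Y} (h𝒦 : 𝒦.Finite) :
    ∃ w, LegalContinuation σ h w ∧ 𝒦 ⊆ ⋃₀ {W | W ∈ w} := by
  induction 𝒦, h𝒦 using Set.Finite.induction_on with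
  | empty => exact ⟨[], fun l x hl => by simp at hl, empty_subset _⟩
  | @insert y s _ _ ih =>
    obtain ⟨w, hw, hs⟩ := ih
    obtain ⟨W, hW, hy⟩ := (hσ (h ++ w)).exists_mem y
    refine ⟨w ++ [W], hw.concat hW, insert_subset ⟨W, by simp, hy⟩ (hs.trans ?_)⟩
    exact sUnion_subset_sUnion fun V hV => List.mem_append_left _ hV

/-- The proper open sets `U` such that the nonempty finite subsets of `U` are covered by the
members of some nonempty legal continuation of the run `h` against `σ`. -/
def continuationOpens (σ : List (Set (PFinH X)) → Set (Set (PFinH X)))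
    (h : List (Set (PFinH X))) : Set (Set X) :=
  {U | IsOpen U ∧ U ≠ univ ∧
    ∃ w ≠ [], LegalContinuation σ h w ∧ pfinLower U ⊆ ⋃₀ {W | W ∈ w}}

lemma isOmegaCover_continuationOpens [T1Space X] [Infinite X]
    {σ : List (Set (PFinH X)) → Set (Set (PFinH X))}
    (hσ : ∀ h, IsNontrivialOpenCover (PFinH X) (σ h)) (h : List (Set (PFinH X))) :
    IsOmegaCover X (continuationOpens σ h) := by
  refine isOmegaCover_of_finite (fun U hU => hU.1) (fun U hU => hU.2.1) fun F hF => ?_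
  obtain ⟨x⟩ := (inferInstance : Nonempty X)
  have hF' := hF.insert x
  obtain ⟨w, hw, hFw⟩ := exists_legalContinuation hσ h (finite_pfinLower hF')
  have hwo : ∀ W ∈ w, IsOpen W := fun W hW => by
    obtain ⟨l, t, rfl⟩ := List.append_of_mem hW
    exact (hσ _).1 W (hw l W ⟨t, by simp⟩)
  obtain ⟨U, hUo, hUne, hFU, hU⟩ := exists_isOpen_pfinLower_subset
    (isOpen_sUnion hwo) hF' hFw
  refine ⟨U, ⟨hUo, hUne, w, ?_, hw, hU⟩, (subset_insert x F).trans hFU⟩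
  rintro rfl
  obtain ⟨W, hW, -⟩ := hFw (a := pfinMk _ hF' (insert_nonempty x F)) Subset.rfl
  simp at hW

lemma OneWin1.pfin_open_omega [T1Space X] [Infinite X]
    (h : OneWin1 (openCovers (PFinH X)) (openCovers (PFinH X))) :
    OneWin1 (omegaCovers X) (omegaCovers X) := by
  obtain ⟨σ, hσ, hwin⟩ := h
  have hex : ∀ (h : List (Set (PFinH X))) (U : Set X), ∃ w : List (Set (PFinH X)),
      U ∈ continuationOpens σ h →
        w ≠ [] ∧ LegalContinuation σ h w ∧ pfinLower U ⊆ ⋃₀ {W | W ∈ w} := by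
    intro h U
    by_cases hU : U ∈ continuationOpens σ h
    · obtain ⟨w, hw⟩ := hU.2.2
      exact ⟨w, fun _ => hw⟩
    · exact ⟨[], fun h' => absurd h' hU⟩
  choose e he using hex
  let tr : List (Set X) → List (Set (PFinH X)) := fun l => l.foldl (fun acc U => acc ++ e acc U) []
  refine ⟨fun l => continuationOpens σ (tr l), fun l => isOmegaCover_continuationOpens hσ _,
    fun U hU hω => ?_⟩
  let H : ℕ → List (Set (PFinH X)) := fun n => tr (List.ofFn fun i : Fin n => U i)
  have hH : ∀ n, H (n + 1) = H n ++ e (H n) (U n) := fun n => foldl_ofFn_succ _ _ _ _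
  have hspec := fun n => he (H n) (U n) (hU n)
  have hlegal : ∀ n, LegalContinuation σ [] (H n) := fun n => by
    induction n with
    | zero =>
      intro l x hl
      simp [H, tr] at hl
    | succ n ih => exact hH n ▸ ih.append (hspec n).2.1
  have hlen : ∀ n, n ≤ (H n).length := fun n => by
    induction n with
    | zero => exact Nat.zero_le _
    | succ n ih =>
      have := List.length_pos_iff.2 (hspec n).1
      rw [hH, List.length_append]
      omega
  obtain ⟨W, hW⟩ := exists_limit_of_prefix_chain H
    (fun n => hH n ▸ List.prefix_append _ _) fun k => ⟨k + 1, hlen (k + 1)⟩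
  have hWσ : ∀ k, W k ∈ σ (List.ofFn fun i : Fin k => W i) := fun k => by
    have hpre := ofFn_prefix_ofFn W (hlen (k + 1))
    rw [← hW, List.ofFn_succ_last] at hpre
    exact hlegal _ _ _ hpre
  refine hwin W hWσ (isNontrivialOpenCover_of_pfinLower hω ?_ ?_ ?_)
  · rintro _ ⟨n, rfl⟩
    exact (hσ _).1 _ (hWσ n)
  · rintro ⟨n, hn⟩
    exact (hσ _).2.2 (hn ▸ hWσ n)
  · rintro _ ⟨n, rfl⟩
    refine (hspec n).2.2.trans (sUnion_subset_sUnion fun V hV => ?_)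
    have hV' : V ∈ H (n + 1) := hH n ▸ List.mem_append_right _ hV
    rw [hW (n + 1)] at hV'
    obtain ⟨i, hi⟩ := List.mem_ofFn.1 hV'
    exact ⟨i, hi⟩

/-- The proper open sets `U` such that the nonempty finite subsets of `U` are covered by a sequence
selecting one member from each `𝒲 i`. -/
def sequenceOpens (𝒲 : ℕ → Set (Set (PFinH X))) : Set (Set X) :=
  {U | IsOpen U ∧ U ≠ univ ∧
    ∃ W : ℕ → Set (PFinH X), (∀ i, W i ∈ 𝒲 i) ∧ pfinLower U ⊆ ⋃ i, W i}

lemma isOmegaCover_sequenceOpens [T1Space X] [Infinite X] {𝒲 : ℕ → Set (Set (PFinH X))}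
    (h𝒲 : ∀ i, IsNontrivialOpenCover (PFinH X) (𝒲 i)) : IsOmegaCover X (sequenceOpens 𝒲) := by
  refine isOmegaCover_of_finite (fun U hU => hU.1) (fun U hU => hU.2.1) fun F hF => ?_
  obtain ⟨x⟩ := (inferInstance : Nonempty X)
  have hF' := hF.insert x
  obtain ⟨e, he⟩ := (finite_pfinLower hF').countable.exists_eq_range
    ⟨pfinMk _ hF' (insert_nonempty x F), Subset.rfl⟩
  choose W hW heW using fun i => (h𝒲 i).exists_mem (e i)
  have hsub : pfinLower (insert x F) ⊆ ⋃ i, W i := by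
    rw [he]
    rintro _ ⟨i, rfl⟩
    exact mem_iUnion.2 ⟨i, heW i⟩
  obtain ⟨U, hUo, hUne, hFU, hU⟩ := exists_isOpen_pfinLower_subset
    (isOpen_iUnion fun i => (h𝒲 i).1 _ (hW i)) hF' hsub
  exact ⟨U, ⟨hUo, hUne, W, hW, hU⟩, (subset_insert x F).trans hFU⟩

lemma exists_selection_of_sequenceOpens {𝒲 : ℕ → Set (Set (PFinH X))}
    (h𝒲 : ∀ i, IsNontrivialOpenCover (PFinH X) (𝒲 i)) {U : ℕ → Set X}
    (hU : ∀ n, U n ∈ sequenceOpens fun i => 𝒲 (Nat.pair n i)) (hω : IsOmegaCover X (range U)) :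
    ∃ W : ℕ → Set (PFinH X), (∀ k, W k ∈ 𝒲 k) ∧ IsNontrivialOpenCover (PFinH X) (range W) := by
  choose hUo hUne W hW hUW using hU
  have hmem : ∀ k, W k.unpair.1 k.unpair.2 ∈ 𝒲 k := fun k => by
    simpa using hW k.unpair.1 k.unpair.2
  refine ⟨fun k => W k.unpair.1 k.unpair.2, hmem,
    isNontrivialOpenCover_of_pfinLower hω ?_ ?_ ?_⟩
  · rintro _ ⟨k, rfl⟩
    exact (h𝒲 k).1 _ (hmem k)
  · rintro ⟨k, hk⟩
    exact (h𝒲 k).2.2 (hk ▸ hmem k)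
  · rintro _ ⟨n, rfl⟩
    exact (hUW n).trans (iUnion_subset fun i =>
      subset_sUnion_of_mem ⟨Nat.pair n i, by simp⟩)

lemma leTwo1_omega_pfin_open [T1Space X] [Infinite X] :
    LeTwo1 (omegaCovers X) (omegaCovers X) (openCovers (PFinH X)) (openCovers (PFinH X)) := by
  refine ⟨TwoMarkov1.omega_pfin_open, TwoWin1.omega_pfin_open, mt OneWin1.pfin_open_omega,
    mt ?_, mt ?_⟩
  · rintro ⟨σ, hσ, hwin⟩
    refine ⟨fun n => sequenceOpens fun i => σ (Nat.pair n i),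
      fun n => isOmegaCover_sequenceOpens fun i => hσ _, fun U hU hω => ?_⟩
    obtain ⟨W, hW, hcov⟩ := exists_selection_of_sequenceOpens hσ hU hω
    exact hwin W hW hcov
  · rintro ⟨𝒲, h𝒲, hwin⟩
    refine ⟨sequenceOpens fun _ => 𝒲, isOmegaCover_sequenceOpens fun _ => h𝒲, fun U hU hω => ?_⟩
    obtain ⟨W, hW, hcov⟩ :=
      exists_selection_of_sequenceOpens (𝒲 := fun _ => 𝒲) (fun _ => h𝒲) hU hω
    exact hwin W hW hcov

end SingleSelection

/-- For any infinite Hausdorff space `X` and `□ ∈ {1, fin}`: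
`G_□(Ω_X,Ω_X) ≡ G_□(Ω_{P_fin(X)},Ω_{P_fin(X)}) ≡ G_□(O_{P_fin(X)},O_{P_fin(X)})`. -/
theorem statement10 {X : Type*} [TopologicalSpace X] [T2Space X] [Infinite X] :
    (Equiv1 (omegaCovers X) (omegaCovers X)
        (omegaCovers (PFinH X)) (omegaCovers (PFinH X)) ∧
     Equiv1 (omegaCovers (PFinH X)) (omegaCovers (PFinH X))
        (openCovers (PFinH X)) (openCovers (PFinH X))) ∧
    (EquivFin (omegaCovers X) (omegaCovers X)
        (omegaCovers (PFinH X)) (omegaCovers (PFinH X)) ∧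
     EquivFin (omegaCovers (PFinH X)) (omegaCovers (PFinH X))
        (openCovers (PFinH X)) (openCovers (PFinH X))) := by
  have homega : omegaCovers (PFinH X) ⊆ openCovers (PFinH X) := fun 𝒰 h => h.1
  have h₁ : LeTwo1 (omegaCovers (PFinH X)) (omegaCovers (PFinH X))
      (omegaCovers X) (omegaCovers X) := leTwo1_pfin_omega Subset.rfl homega
  have h₂ : LeTwo1 (openCovers (PFinH X)) (openCovers (PFinH X))
      (omegaCovers X) (omegaCovers X) := leTwo1_pfin_omega homega Subset.rfl
  have h₃ : LeTwoFin (omegaCovers (PFinH X)) (omegaCovers (PFinH X))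
      (omegaCovers X) (omegaCovers X) := leTwoFin_pfin_omega Subset.rfl homega
  have h₄ : LeTwoFin (openCovers (PFinH X)) (openCovers (PFinH X))
      (omegaCovers X) (omegaCovers X) := leTwoFin_pfin_omega homega Subset.rfl
  exact ⟨⟨leTwo1_omega_pfin_omega.antisymm h₁,
      (h₁.trans leTwo1_omega_pfin_open).antisymm (h₂.trans leTwo1_omega_pfin_omega)⟩,
    leTwoFin_omega_pfin_omega.antisymm h₃,
      (h₃.trans leTwoFin_omega_pfin_open).antisymm (h₄.trans leTwoFin_omega_pfin_omega)⟩
end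

section
/- For any infinite Hausdorff space X, the following are equivalent: (a) X is an ε-space; (b) P_fin(X) is an ε-space; (c) P_fin(X) is Lindelöf. -/
open Set

theorem exists_open_assignment_of_mem {X : Type*} [TopologicalSpace X] {O : Set (KHyper X)}
    (hO : IsOpen O) (S : KHyper X) (hS : S ∈ O) :
    ∃ v : X → Set X, (∀ x ∈ S.1, IsOpen (v x) ∧ x ∈ v x) ∧
      ∀ K : KHyper X, K.1 ⊆ ⋃ x ∈ S.1, v x → (∀ x ∈ S.1, (K.1 ∩ v x).Nonempty) → K ∈ O := by
  induction hO with
  | basic O h =>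
    rcases h with ⟨U, hU, rfl⟩ | ⟨U, hU, rfl⟩
    · exact ⟨fun _ => U, fun x hx => ⟨hU, hS hx⟩,
        fun K hK _ => hK.trans (iUnion₂_subset fun _ _ => subset_rfl)⟩
    · classical
      obtain ⟨a, haS, haU⟩ := hS
      refine ⟨fun x => if x ∈ U then U else univ, fun x _ => ?_, fun K _ hK => ?_⟩
      · dsimp only
        split_ifs with h
        · exact ⟨hU, h⟩
        · exact ⟨isOpen_univ, mem_univ x⟩
      · simpa [haU] using hK a haS
  | univ => exact ⟨fun _ => univ, fun x _ => ⟨isOpen_univ, mem_univ x⟩, fun _ _ _ => mem_univ _⟩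
  | inter O₁ O₂ _ _ ih₁ ih₂ =>
    obtain ⟨v, hv, hvO⟩ := ih₁ hS.1
    obtain ⟨w, hw, hwO⟩ := ih₂ hS.2
    refine ⟨fun x => v x ∩ w x,
      fun x hx => ⟨(hv x hx).1.inter (hw x hx).1, (hv x hx).2, (hw x hx).2⟩,
      fun K hK hne => ⟨hvO K ?_ fun x hx => ?_, hwO K ?_ fun x hx => ?_⟩⟩
    · exact hK.trans (iUnion₂_mono fun _ _ => inter_subset_left)
    · exact (hne x hx).mono (inter_subset_inter_right _ inter_subset_left)
    · exact hK.trans (iUnion₂_mono fun _ _ => inter_subset_right)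
    · exact (hne x hx).mono (inter_subset_inter_right _ inter_subset_right)
  | sUnion 𝒪 _ ih =>
    obtain ⟨O, hO, hSO⟩ := hS
    obtain ⟨v, hv, hvO⟩ := ih O hO hSO
    exact ⟨v, hv, fun K hK hne => ⟨O, hO, hvO K hK hne⟩⟩

/-- An open set of `P_fin(X)` containing every nonempty subset of a finite set `F` contains
every nonempty finite subset of some open neighbourhood of `F`. -/
theorem exists_isOpen_superset_of_subsets_mem {X : Type*} [TopologicalSpace X]
    {O : Set (PFinH X)} (hO : IsOpen O) {F : Set X} (hF : F.Finite)
    (hFO : ∀ S : PFinH X, S.1.1 ⊆ F → S ∈ O) :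
    ∃ V : Set X, IsOpen V ∧ F ⊆ V ∧ ∀ K : PFinH X, K.1.1 ⊆ V → K ∈ O := by
  obtain ⟨O', hO', rfl⟩ := isOpen_induced_iff.mp hO
  have key : ∀ S : Set X, ∃ v : X → Set X, S.Nonempty → S ⊆ F →
      (∀ x ∈ S, IsOpen (v x) ∧ x ∈ v x) ∧
      ∀ K : KHyper X, K.1 ⊆ ⋃ x ∈ S, v x → (∀ x ∈ S, (K.1 ∩ v x).Nonempty) → K ∈ O' := by
    intro S
    by_cases h : S.Nonempty ∧ S ⊆ F
    · have hS := hF.subset h.2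
      obtain ⟨v, hv⟩ := exists_open_assignment_of_mem hO' ⟨S, hS.isCompact, h.1⟩
        (hFO ⟨⟨S, hS.isCompact, h.1⟩, hS⟩ h.2)
      exact ⟨v, fun _ _ => hv⟩
    · exact ⟨fun _ => univ, fun h₁ h₂ => (h ⟨h₁, h₂⟩).elim⟩
  choose v hv using key
  let V : X → Set X := fun x => ⋂ S ∈ {S | S ⊆ F ∧ x ∈ S}, v S x
  have hfin : ∀ x, {S | S ⊆ F ∧ x ∈ S}.Finite := fun x => hF.finite_subsets.subset fun S hS => hS.1
  have hVv : ∀ {S x}, S ⊆ F → x ∈ S → V x ⊆ v S x := fun {S x} hS hx =>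
    biInter_subset_of_mem (show S ∈ {S | S ⊆ F ∧ x ∈ S} from ⟨hS, hx⟩)
  refine ⟨⋃ x ∈ F, V x, isOpen_biUnion fun x _ => (hfin x).isOpen_biInter fun S hS =>
    ((hv S ⟨x, hS.2⟩ hS.1).1 x hS.2).1, fun x hx => mem_iUnion₂.mpr ⟨x, hx,
    mem_iInter₂.mpr fun S hS => ((hv S ⟨x, hS.2⟩ hS.1).1 x hS.2).2⟩, fun K hK => ?_⟩
  let S : Set X := {x ∈ F | (K.1.1 ∩ V x).Nonempty}
  have hSF : S ⊆ F := sep_subset _ _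
  have hKS : ∀ y ∈ K.1.1, ∃ x ∈ S, y ∈ V x := by
    intro y hy
    obtain ⟨x, hx, hyx⟩ := mem_iUnion₂.mp (hK hy)
    exact ⟨x, ⟨hx, y, hy, hyx⟩, hyx⟩
  obtain ⟨y, hy⟩ := K.1.2.2
  obtain ⟨x, hxS, _⟩ := hKS y hy
  refine (hv S ⟨x, hxS⟩ hSF).2 K.1 (fun z hz => ?_) fun z hz => ?_
  · obtain ⟨x, hx, hzx⟩ := hKS z hz
    exact mem_iUnion₂.mpr ⟨x, hx, hVv hSF hx hzx⟩
  · exact hz.2.mono (inter_subset_inter_right _ (hVv hSF hz))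

theorem isOmegaCover_of_forall_finite {Y : Type*} [TopologicalSpace Y] {𝒰 : Set (Set Y)}
    (ho : ∀ U ∈ 𝒰, IsOpen U) (hne : univ ∉ 𝒰)
    (h : ∀ F : Set Y, F.Finite → ∃ U ∈ 𝒰, F ⊆ U) : IsOmegaCover Y 𝒰 := by
  refine ⟨⟨ho, eq_univ_of_forall fun y => ?_, hne⟩, h⟩
  obtain ⟨U, hU, hyU⟩ := h {y} (finite_singleton y)
  exact ⟨U, hU, hyU rfl⟩

theorem IsEpsilonSpace.isLindelofSp {Y : Type*} [TopologicalSpace Y] (hY : IsEpsilonSpace Y) :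
    IsLindelofSp Y := by
  intro 𝒰 ho hcov
  let 𝒲 : Set (Set Y) := sUnion '' {𝒢 | 𝒢 ⊆ 𝒰 ∧ 𝒢.Finite}
  by_cases huniv : univ ∈ 𝒲
  · obtain ⟨𝒢, ⟨h𝒢, hfin⟩, hU⟩ := huniv
    exact ⟨𝒢, h𝒢, hfin.countable, hU⟩
  have h𝒲 : IsOmegaCover Y 𝒲 := by
    refine isOmegaCover_of_forall_finite ?_ huniv fun F hF => ?_
    · rintro _ ⟨𝒢, ⟨h𝒢, _⟩, rfl⟩
      exact isOpen_sUnion fun U hU => ho U (h𝒢 hU)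
    · have hmem : ∀ y : Y, ∃ U ∈ 𝒰, y ∈ U := fun y => mem_sUnion.mp (hcov ▸ mem_univ y)
      choose u hu hyu using hmem
      exact ⟨⋃₀ (u '' F), ⟨u '' F, ⟨image_subset_iff.mpr fun y _ => hu y, hF.image u⟩, rfl⟩,
        fun y hy => ⟨u y, mem_image_of_mem u hy, hyu y⟩⟩
  obtain ⟨𝒱, h𝒱, hc, hω⟩ := hY 𝒲 h𝒲
  have hex : ∀ V ∈ 𝒱, ∃ 𝒢, (𝒢 ⊆ 𝒰 ∧ 𝒢.Finite) ∧ ⋃₀ 𝒢 = V := fun V hV => h𝒱 hV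
  choose! g hg hgV using hex
  refine ⟨⋃ V ∈ 𝒱, g V, iUnion₂_subset fun V hV => (hg V hV).1,
    hc.biUnion fun V hV => (hg V hV).2.countable, eq_univ_of_forall fun y => ?_⟩
  obtain ⟨V, hV, hyV⟩ := mem_sUnion.mp (hω.1.2.1 ▸ mem_univ y : y ∈ ⋃₀ 𝒱)
  rw [← hgV V hV] at hyV
  obtain ⟨U, hU, hyU⟩ := hyV
  exact ⟨U, mem_iUnion₂.mpr ⟨V, hV, hU⟩, hyU⟩

theorem IsEpsilonSpace.pFinH {X : Type*} [TopologicalSpace X] (hX : IsEpsilonSpace X) :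
    IsEpsilonSpace (PFinH X) := by
  intro 𝒲 h𝒲
  let 𝒰 : Set (Set X) := {V | IsOpen V ∧ ∃ W ∈ 𝒲, ∀ K : PFinH X, K.1.1 ⊆ V → K ∈ W}
  have h𝒰 : IsOmegaCover X 𝒰 := by
    refine isOmegaCover_of_forall_finite (fun V hV => hV.1) ?_ fun F hF => ?_
    · rintro ⟨_, W, hW, hKW⟩
      exact h𝒲.1.2.2 (eq_univ_of_forall (fun K => hKW K (subset_univ _)) ▸ hW)
    · have hsub : {S : PFinH X | S.1.1 ⊆ F}.Finite :=
        hF.finite_subsets.preimage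
          (f := fun S : PFinH X => S.1.1)
          (Subtype.val_injective.comp Subtype.val_injective).injOn
      obtain ⟨W, hW, hFW⟩ := h𝒲.2 _ hsub
      obtain ⟨V, hV, hFV, hVW⟩ := exists_isOpen_superset_of_subsets_mem (h𝒲.1.1 W hW) hF hFW
      exact ⟨V, ⟨hV, W, hW, hVW⟩, hFV⟩
  obtain ⟨𝒱, h𝒱, hc, hω⟩ := hX 𝒰 h𝒰
  have hex : ∀ V ∈ 𝒱, ∃ W ∈ 𝒲, ∀ K : PFinH X, K.1.1 ⊆ V → K ∈ W := fun V hV => (h𝒱 hV).2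
  choose! w hw hVw using hex
  have hsub : w '' 𝒱 ⊆ 𝒲 := image_subset_iff.mpr hw
  refine ⟨w '' 𝒱, hsub, hc.image w, isOmegaCover_of_forall_finite
    (fun W hW => h𝒲.1.1 W (hsub hW)) (fun h => h𝒲.1.2.2 (hsub h)) fun 𝓕 h𝓕 => ?_⟩
  obtain ⟨V, hV, hFV⟩ := hω.2 (⋃ K ∈ 𝓕, K.1.1) (h𝓕.biUnion fun K _ => K.2)
  exact ⟨w V, mem_image_of_mem w hV,
    fun K hK => hVw V hV K ((subset_biUnion_of_mem (u := fun K : PFinH X => K.1.1) hK).trans hFV)⟩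

theorem isEpsilonSpace_of_isLindelofSp_pFinH {X : Type*} [TopologicalSpace X] [Nonempty X]
    (h : IsLindelofSp (PFinH X)) : IsEpsilonSpace X := by
  intro 𝒰 h𝒰
  let b : Set X → Set (PFinH X) := fun U => {K | K.1.1 ⊆ U}
  have hb : ∀ U ∈ 𝒰, IsOpen (b U) := fun U hU =>
    isOpen_induced (TopologicalSpace.isOpen_generateFrom_of_mem
      (Or.inl ⟨U, h𝒰.1.1 U hU, rfl⟩) : IsOpen {K : KHyper X | K.1 ⊆ U})
  obtain ⟨𝒮, h𝒮, hc, hcov⟩ := h (b '' 𝒰) (forall_mem_image.mpr hb)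
    (eq_univ_of_forall fun K => by
      obtain ⟨U, hU, hKU⟩ := h𝒰.2 K.1.1 K.2
      exact ⟨b U, mem_image_of_mem b hU, hKU⟩)
  have hex : ∀ S ∈ 𝒮, ∃ U ∈ 𝒰, b U = S := fun S hS => h𝒮 hS
  choose! u hu hbu using hex
  have hsub : u '' 𝒮 ⊆ 𝒰 := image_subset_iff.mpr hu
  refine ⟨u '' 𝒮, hsub, hc.image u, isOmegaCover_of_forall_finite
    (fun U hU => h𝒰.1.1 U (hsub hU)) (fun h => h𝒰.1.2.2 (hsub h)) fun F hF => ?_⟩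
  let x : X := Classical.arbitrary X
  have hF' : (insert x F).Finite := hF.insert x
  let K : PFinH X := ⟨⟨insert x F, hF'.isCompact, insert_nonempty x F⟩, hF'⟩
  obtain ⟨S, hS, hKS⟩ := mem_sUnion.mp (hcov ▸ mem_univ K : K ∈ ⋃₀ 𝒮)
  rw [← hbu S hS] at hKS
  exact ⟨u S, mem_image_of_mem u hS, (subset_insert x F).trans hKS⟩

/-- For any infinite Hausdorff space `X`, the following are equivalent:
(a) `X` is an ε-space; (b) `P_fin(X)` is an ε-space; (c) `P_fin(X)` is Lindelöf. -/
theorem statement11 {X : Type*} [TopologicalSpace X] [T2Space X] [Infinite X] :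
    (IsEpsilonSpace X ↔ IsEpsilonSpace (PFinH X)) ∧
    (IsEpsilonSpace (PFinH X) ↔ IsLindelofSp (PFinH X)) := by
  have hca := isEpsilonSpace_of_isLindelofSp_pFinH (X := X)
  exact ⟨⟨fun h => h.pFinH, fun h => hca h.isLindelofSp⟩,
    ⟨fun h => h.isLindelofSp, fun h => (hca h).pFinH⟩⟩
end

section
/- Let X be an infinite, non-compact Hausdorff space. (a) If 𝒰 is a k-cover of X, then { [U] : U ∈ 𝒰 } is a k-cover of 𝕂(X). (b) If 𝒰 is a k-cover of 𝕂(X), then 𝒱 = { V ∈ 𝒯_X : there exists U ∈ 𝒰 with [V] ⊆ U } is a k-cover of X. -/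
open Set

section VietorisLemmas

open Filter Topology

variable {X : Type*} [TopologicalSpace X]

theorem vLower_mono : Monotone (vLower X) := fun _ _ h _ hK => hK.trans h

theorem isOpen_vLower {U : Set X} (hU : IsOpen U) : IsOpen (vLower X U) :=
  TopologicalSpace.isOpen_generateFrom_of_mem (.inl ⟨U, hU, rfl⟩)

/-- The point `{x}` of `𝕂(X)`. -/
def singletonKHyper (x : X) : KHyper X := ⟨{x}, isCompact_singleton, singleton_nonempty x⟩

theorem singletonKHyper_mem_vLower {x : X} {U : Set X} :
    singletonKHyper x ∈ vLower X U ↔ x ∈ U :=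
  singleton_subset_iff

theorem vLower_eq_univ_iff {U : Set X} : vLower X U = univ ↔ U = univ := by
  refine ⟨fun h => eq_univ_of_forall fun x => ?_, fun h => ?_⟩
  · exact singletonKHyper_mem_vLower.1 (h ▸ mem_univ _)
  · subst h
    exact eq_univ_of_forall fun K => subset_univ K.1

/-- An ultrafilter on `𝕂(X)` that eventually lies below every open neighbourhood of a compact set
converges to some compact subset of that set. -/
theorem exists_le_nhds_of_vLower_mem [T2Space X] {K : Set X} (hK : IsCompact K)
    (G : Ultrafilter (KHyper X)) (hG : ∀ V, IsOpen V → K ⊆ V → vLower X V ∈ G) :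
    ∃ L ∈ vLower X K, (G : Filter (KHyper X)) ≤ 𝓝 L := by
  let C : Set X := {x | ∀ U, IsOpen U → x ∈ U → {M : KHyper X | (M.1 ∩ U).Nonempty} ∈ G}
  have hC : IsClosed C := by
    refine isOpen_compl_iff.1 (isOpen_iff_forall_mem_open.2 fun x hx => ?_)
    simp only [C, mem_compl_iff, mem_ofPred_eq, not_forall] at hx
    obtain ⟨U, hU, hxU, hUG⟩ := hx
    exact ⟨U, fun y hy hyC => hUG (hyC U hU hy), hU, hxU⟩
  have lower : ∀ U, IsOpen U → K ∩ C ⊆ U → vLower X U ∈ G := by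
    intro U hU hCU
    have hW : ∀ x ∈ K \ U, ∃ W, IsOpen W ∧ x ∈ W ∧ {M : KHyper X | ¬ (M.1 ∩ W).Nonempty} ∈ G := by
      intro x hx
      have hxC : x ∉ C := fun h => hx.2 (hCU ⟨hx.1, h⟩)
      simp only [C, mem_ofPred_eq, not_forall] at hxC
      obtain ⟨W, hW, hxW, hWG⟩ := hxC
      exact ⟨W, hW, hxW, Ultrafilter.compl_mem_iff_notMem.2 hWG⟩
    choose! W hWo hxW hWG using hW
    obtain ⟨t, htK, ht⟩ := (hK.diff hU).elim_nhds_subcover W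
      fun x hx => (hWo x hx).mem_nhds (hxW x hx)
    have hV : vLower X (U ∪ ⋃ x ∈ t, W x) ∈ G :=
      hG _ (hU.union (isOpen_biUnion fun x hx => hWo x (htK x hx))) (sdiff_subset_iff.1 ht)
    have hmiss : ⋂ x ∈ t, {M : KHyper X | ¬ (M.1 ∩ W x).Nonempty} ∈ (G : Filter (KHyper X)) :=
      (biInter_finset_mem t).2 fun x hx => hWG x (htK x hx)
    refine mem_of_superset (inter_mem hV hmiss) fun M hM y hy => ?_
    refine (hM.1 hy).resolve_right fun hyW => ?_
    obtain ⟨x, hx, hyx⟩ := mem_iUnion₂.1 hyW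
    exact mem_iInter₂.1 hM.2 x hx ⟨y, hy, hyx⟩
  have hne : (K ∩ C).Nonempty := by
    rw [nonempty_iff_ne_empty]
    intro h
    obtain ⟨M, hM⟩ := G.neBot.nonempty_of_mem (lower ∅ isOpen_empty h.subset)
    exact (M.2.2.mono hM).ne_empty rfl
  refine ⟨⟨K ∩ C, hK.inter_right hC, hne⟩, inter_subset_left, ?_⟩
  rw [TopologicalSpace.nhds_generateFrom]
  refine le_iInf₂ fun S hS => le_principal_iff.2 ?_
  obtain ⟨hLS, ⟨U, hU, rfl⟩ | ⟨U, hU, rfl⟩⟩ := hS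
  · exact lower U hU hLS
  · obtain ⟨x, hx, hxU⟩ := hLS
    exact hx.2 U hU hxU

theorem isCompact_vLower [T2Space X] {K : Set X} (hK : IsCompact K) : IsCompact (vLower X K) :=
  isCompact_iff_ultrafilter_le_nhds.2 fun G hG => exists_le_nhds_of_vLower_mem hK G
    fun _ _ hKV => mem_of_superset (le_principal_iff.1 hG) (vLower_mono hKV)

/-- The sets `[V]`, for `V` an open neighbourhood of a compact set `K`, form a neighbourhood base
of `[K]`. -/
theorem exists_isOpen_vLower_subset [T2Space X] {K : Set X} (hK : IsCompact K)
    {O : Set (KHyper X)} (hO : IsOpen O) (hKO : vLower X K ⊆ O) :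
    ∃ V, IsOpen V ∧ K ⊆ V ∧ vLower X V ⊆ O := by
  have hmem : O ∈ (𝓝ˢ K).lift' (vLower X) := by
    refine mem_iff_ultrafilter.2 fun G hG => ?_
    obtain ⟨L, hL, hGL⟩ := exists_le_nhds_of_vLower_mem hK G
      fun V hV hKV => hG (mem_lift' (hV.mem_nhdsSet.2 hKV))
    exact hGL (hO.mem_nhds (hKO hL))
  obtain ⟨t, ht, htO⟩ := (mem_lift'_sets vLower_mono).1 hmem
  obtain ⟨V, hV, hKV, hVt⟩ := mem_nhdsSet_iff_exists.1 ht
  exact ⟨V, hV, hKV, (vLower_mono hVt).trans htO⟩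

theorem isCompact_biUnion_of_isCompact_kHyper {S : Set (KHyper X)} (hS : IsCompact S) :
    IsCompact (⋃ K ∈ S, K.1) := by
  refine isCompact_of_finite_subcover fun {ι} U hU hSU => ?_
  obtain ⟨t, ht⟩ := hS.elim_directed_cover (fun t : Finset ι => vLower X (⋃ i ∈ t, U i))
    (fun t => isOpen_vLower (isOpen_biUnion fun i _ => hU i))
    (fun K hK => by
      obtain ⟨t, ht⟩ := K.2.1.elim_finite_subcover U hU
        ((subset_biUnion_of_mem (u := fun K : KHyper X => K.1) hK).trans hSU)
      exact mem_iUnion.2 ⟨t, ht⟩)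
    (Monotone.directed_le fun s t hst => vLower_mono (biUnion_subset_biUnion_left hst))
  exact ⟨t, iUnion₂_subset fun K hK => ht hK⟩

end VietorisLemmas

/-- k-cover translation for `𝕂(X)` (`X` infinite, non-compact, Hausdorff):
(a) if `𝒰` is a k-cover of `X`, then `{[U] : U ∈ 𝒰}` is a k-cover of `𝕂(X)`;
(b) if `𝒰` is a k-cover of `𝕂(X)`, then
`𝒱 = {V ∈ 𝒯_X : ∃ U ∈ 𝒰, [V] ⊆ U}` is a k-cover of `X`. -/
theorem statement14 {X : Type*} [TopologicalSpace X] [T2Space X] [Infinite X]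
    (hnc : ¬ IsCompact (Set.univ : Set X)) :
    (∀ 𝒰 : Set (Set X), IsKCover X 𝒰 →
      IsKCover (KHyper X) ((fun U => vLower X U) '' 𝒰)) ∧
    (∀ 𝒰 : Set (Set (KHyper X)), IsKCover (KHyper X) 𝒰 →
      IsKCover X
        {V | V ∈ ProperNonemptyOpens X ∧ ∃ U ∈ 𝒰, vLower X V ⊆ U}) := by
  have ne_univ {K : Set X} (hK : IsCompact K) : K ≠ univ := fun h => hnc (h ▸ hK)
  constructor
  · rintro 𝒰 ⟨⟨hopen, -, hproper⟩, hcover⟩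
    refine ⟨⟨?_, eq_univ_of_forall fun K => ?_, ?_⟩, fun S hS _ => ?_⟩
    · rintro _ ⟨U, hU, rfl⟩
      exact isOpen_vLower (hopen U hU)
    · obtain ⟨U, hU, hKU⟩ := hcover K.1 K.2.1 (ne_univ K.2.1)
      exact ⟨_, mem_image_of_mem _ hU, hKU⟩
    · rintro ⟨U, hU, h⟩
      exact hproper (vLower_eq_univ_iff.1 h ▸ hU)
    · have hc := isCompact_biUnion_of_isCompact_kHyper hS
      obtain ⟨U, hU, hSU⟩ := hcover _ hc (ne_univ hc)
      exact ⟨_, mem_image_of_mem _ hU, fun K hK => (subset_biUnion_of_mem hK).trans hSU⟩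
  · rintro 𝒰 ⟨⟨hopen, -, hproper⟩, hcover⟩
    have key : ∀ K : Set X, IsCompact K → K.Nonempty →
        ∃ V ∈ {V | V ∈ ProperNonemptyOpens X ∧ ∃ U ∈ 𝒰, vLower X V ⊆ U}, K ⊆ V := by
      intro K hK hne
      obtain ⟨U, hU, hKU⟩ := hcover _ (isCompact_vLower hK) (mt vLower_eq_univ_iff.1 (ne_univ hK))
      obtain ⟨V, hV, hKV, hVU⟩ := exists_isOpen_vLower_subset hK (hopen U hU) hKU
      refine ⟨V, ⟨⟨hV, hne.mono hKV, fun h => hproper ?_⟩, U, hU, hVU⟩, hKV⟩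
      rw [vLower_eq_univ_iff.2 h, univ_subset_iff] at hVU
      exact hVU ▸ hU
    refine ⟨⟨fun V hV => hV.1.1, eq_univ_of_forall fun x => ?_, fun h => h.1.2.2 rfl⟩,
      fun K hK _ => ?_⟩
    · obtain ⟨V, hV, hxV⟩ := key {x} isCompact_singleton (singleton_nonempty x)
      exact ⟨V, hV, hxV rfl⟩
    · obtain ⟨x⟩ : Nonempty X := inferInstance
      obtain ⟨V, hV, hKV⟩ := key (insert x K) (hK.insert x) (insert_nonempty x K)
      exact ⟨V, hV, (subset_insert x K).trans hKV⟩
end
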